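/- arXiv:math/0603344 — 2 statements merged into one kernel-verified Lean document; each statement's English description precedes it below -/
import Mathlib

section
/- The arcsine law for stable subordinators: Let V be an α-stable subordinator (α ∈ (0,1), scale c > 0) and let T(x) = inf{t ≥ 0 : V(t) > x}. Then for every x > 0 the random variable V(T(x)−)/x has the generalised arcsine distribution with parameter α, i.e. P[V(T(x)−)/x ≤ u] = Asl_α(u) for u ∈ [0,1]. -/
open MeasureTheory ProbabilityTheory Filter Set
open scoped ENNReal NNReal Classical

/-- The distribution function of the generalised arcsine law with parameter `α`. -/
noncomputable def Asl (α u : ℝ) : ℝ :=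
  Real.sin (α * Real.pi) / Real.pi * ∫ v in (0:ℝ)..u, v ^ (α - 1) * (1 - v) ^ (-α)

/-- Finite measures on the quadrant are determined by their Laplace transforms at integers. -/
theorem laplace_ext_quadrant {P Q : Measure (ℝ≥0 × ℝ≥0)} [IsFiniteMeasure P] [IsFiniteMeasure Q]
    (h : ∀ m n : ℕ, ∫⁻ z, ENNReal.ofReal (Real.exp (-(m * (z.1 : ℝ) + n * (z.2 : ℝ)))) ∂P
      = ∫⁻ z, ENNReal.ofReal (Real.exp (-(m * (z.1 : ℝ) + n * (z.2 : ℝ)))) ∂Q) : P = Q := by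
  let f : BoundedContinuousFunction (ℝ≥0 × ℝ≥0) ℝ :=
    BoundedContinuousFunction.ofNormedAddCommGroup (fun z => Real.exp (-(z.1 : ℝ)))
      (by fun_prop) 1 (fun z => by
        rw [Real.norm_eq_abs, abs_of_pos (Real.exp_pos _)]
        exact Real.exp_le_one_iff.2 (by simp))
  let g : BoundedContinuousFunction (ℝ≥0 × ℝ≥0) ℝ :=
    BoundedContinuousFunction.ofNormedAddCommGroup (fun z => Real.exp (-(z.2 : ℝ)))
      (by fun_prop) 1 (fun z => by
        rw [Real.norm_eq_abs, abs_of_pos (Real.exp_pos _)]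
        exact Real.exp_le_one_iff.2 (by simp))
  let A : StarSubalgebra ℝ (BoundedContinuousFunction (ℝ≥0 × ℝ≥0) ℝ) :=
    { Algebra.adjoin ℝ {f, g} with
      star_mem' := fun {a} ha => by
        have : star a = a := by ext z; simp
        rw [this]; exact ha }
  have hfA : f ∈ A := Algebra.subset_adjoin (by simp)
  have hgA : g ∈ A := Algebra.subset_adjoin (by simp)
  apply ext_of_forall_mem_subalgebra_integral_eq_of_pseudoEMetric_complete_countable (A := A)
  · intro x y hxy
    have : x.1 ≠ y.1 ∨ x.2 ≠ y.2 := by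
      by_contra! hc
      exact hxy (Prod.ext hc.1 hc.2)
    rcases this with h1 | h1
    · refine ⟨f, ⟨BoundedContinuousFunction.toContinuousMapStarₐ ℝ f, ⟨f, hfA, rfl⟩, rfl⟩, ?_⟩
      simpa [f] using h1
    · refine ⟨g, ⟨BoundedContinuousFunction.toContinuousMapStarₐ ℝ g, ⟨g, hgA, rfl⟩, rfl⟩, ?_⟩
      simpa [g] using h1
  · intro k hk
    have hk' : k ∈ Submodule.span ℝ (Submonoid.closure {f, g} : Set _) := by
      rw [← Algebra.adjoin_eq_span]; exact hk
    induction hk' using Submodule.span_induction with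
    | mem x hx =>
      obtain ⟨m, n, rfl⟩ := (Submonoid.mem_closure_pair _ _ _).1 hx
      have key : ∀ z : ℝ≥0 × ℝ≥0, (f ^ m * g ^ n) z
          = Real.exp (-(m * (z.1 : ℝ) + n * (z.2 : ℝ))) := by
        intro z
        simp only [BoundedContinuousFunction.coe_mul, BoundedContinuousFunction.coe_pow,
          Pi.mul_apply, Pi.pow_apply]
        change Real.exp (-(z.1 : ℝ)) ^ m * Real.exp (-(z.2 : ℝ)) ^ n = _
        rw [← Real.exp_nat_mul, ← Real.exp_nat_mul, ← Real.exp_add]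
        ring_nf
      simp_rw [key]
      rw [integral_eq_lintegral_of_nonneg_ae, integral_eq_lintegral_of_nonneg_ae, h]
      · exact Eventually.of_forall fun z => (Real.exp_pos _).le
      · fun_prop
      · exact Eventually.of_forall fun z => (Real.exp_pos _).le
      · fun_prop
    | zero => simp
    | add x y hx hy h1 h2 =>
      have e1 : x ∈ A := by
        change x ∈ Subalgebra.toSubmodule (Algebra.adjoin ℝ {f, g})
        rw [Algebra.adjoin_eq_span]; exact hx
      have e2 : y ∈ A := by
        change y ∈ Subalgebra.toSubmodule (Algebra.adjoin ℝ {f, g})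
        rw [Algebra.adjoin_eq_span]; exact hy
      simp only [BoundedContinuousFunction.coe_add, Pi.add_apply]
      rw [integral_add (x.integrable P) (y.integrable P),
        integral_add (x.integrable Q) (y.integrable Q), h1 e1, h2 e2]
    | smul a x hx h1 =>
      have e1 : x ∈ A := by
        change x ∈ Subalgebra.toSubmodule (Algebra.adjoin ℝ {f, g})
        rw [Algebra.adjoin_eq_span]; exact hx
      simp only [BoundedContinuousFunction.coe_smul]
      rw [integral_smul, integral_smul, h1 e1]

/-- Laplace transform of the gamma law. -/
theorem gamma_laplace {a s : ℝ} (ha : 0 < a) (hs : 0 ≤ s) :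
    ∫⁻ x, ENNReal.ofReal (Real.exp (-(s * x))) ∂(gammaMeasure a 1)
      = ENNReal.ofReal ((1 + s) ^ (-a)) := by
  have h1 : (0:ℝ) < 1 + s := by linarith
  have hm : Measurable (gammaPDF a 1) := (measurable_gammaPDFReal a 1).ennreal_ofReal
  rw [gammaMeasure, lintegral_withDensity_eq_lintegral_mul _ hm (by fun_prop)]
  have : ∀ x, (gammaPDF a 1 * fun x => ENNReal.ofReal (Real.exp (-(s * x)))) x
      = ENNReal.ofReal ((1 + s) ^ (-a)) * gammaPDF a (1 + s) x := by
    intro x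
    simp only [Pi.mul_apply]
    rcases lt_or_ge x 0 with hx | hx
    · simp [gammaPDF_of_neg hx]
    · have := Real.Gamma_pos_of_pos ha
      rw [gammaPDF_of_nonneg hx, gammaPDF_of_nonneg hx, ← ENNReal.ofReal_mul (by positivity),
        ← ENNReal.ofReal_mul (by positivity)]
      congr 1
      rw [Real.rpow_neg h1.le]
      have e : Real.exp (-((1 + s) * x)) = Real.exp (-(1 * x)) * Real.exp (-(s * x)) := by
        rw [← Real.exp_add]; ring_nf
      rw [e]
      have : (1 + s) ^ a ≠ 0 := (Real.rpow_pos_of_pos h1 a).ne'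
      simp only [Real.one_rpow]
      field_simp
  simp_rw [this]
  rw [lintegral_const_mul _ (show Measurable (gammaPDF a (1 + s)) from
    (measurable_gammaPDFReal a _).ennreal_ofReal),
    lintegral_gammaPDF_eq_one ha h1, mul_one]

theorem gamma_ae_pos {a : ℝ} : ∀ᵐ x ∂(gammaMeasure a 1), 0 < x := by
  have hm : Measurable (gammaPDF a 1) := (measurable_gammaPDFReal a 1).ennreal_ofReal
  rw [gammaMeasure, ae_withDensity_iff hm]
  have : ∀ᵐ x : ℝ, x ≠ 0 := by simp [ae_iff]
  filter_upwards [this] with x hx h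
  by_contra hc
  exact h (gammaPDF_of_neg (lt_of_le_of_ne (not_lt.1 hc) hx))

/-- Arcsine density. -/
noncomputable def aslDens (α v : ℝ) : ℝ :=
  Real.sin (α * Real.pi) / Real.pi * (v ^ (α - 1) * (1 - v) ^ (-α))

theorem gamma_pair_laplace {α : ℝ} (hα : α ∈ Set.Ioo (0:ℝ) 1) (m n : ℕ) :
    ∫⁻ z : ℝ≥0 × ℝ≥0, ENNReal.ofReal (Real.exp (-(m * (z.1 : ℝ) + n * (z.2 : ℝ))))
      ∂(((gammaMeasure (1 - α) 1).prod (gammaMeasure α 1)).map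
        (fun p => ((p.1 + p.2).toNNReal, p.2.toNNReal)))
      = ENNReal.ofReal ((1 + m : ℝ) ^ (α - 1) * (1 + m + n : ℝ) ^ (-α)) := by
  have hp1 := isProbabilityMeasure_gammaMeasure (a := 1 - α) (r := 1) (by linarith [hα.2]) one_pos
  have hp2 := isProbabilityMeasure_gammaMeasure (a := α) (r := 1) hα.1 one_pos
  rw [lintegral_map (by fun_prop) (by fun_prop)]
  rw [lintegral_prod _ (by fun_prop)]
  have : ∀ᵐ a ∂(gammaMeasure (1 - α) 1),
      ∫⁻ b, ENNReal.ofReal (Real.exp (-(m * ((a + b).toNNReal : ℝ) + n * (b.toNNReal : ℝ))))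
        ∂(gammaMeasure α 1)
      = ENNReal.ofReal (Real.exp (-(m * a))) * ENNReal.ofReal ((1 + m + n : ℝ) ^ (-α)) := by
    filter_upwards [gamma_ae_pos] with a ha
    have : ∀ᵐ b ∂(gammaMeasure α 1),
      ENNReal.ofReal (Real.exp (-(m * ((a + b).toNNReal : ℝ) + n * (b.toNNReal : ℝ))))
      = ENNReal.ofReal (Real.exp (-(m * a))) * ENNReal.ofReal (Real.exp (-((m + n : ℝ) * b))) := by
      filter_upwards [gamma_ae_pos] with b hb
      rw [Real.coe_toNNReal _ (by linarith), Real.coe_toNNReal _ hb.le,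
        ← ENNReal.ofReal_mul (by positivity), ← Real.exp_add]
      ring_nf
    rw [lintegral_congr_ae this, lintegral_const_mul _ (by fun_prop),
      gamma_laplace hα.1 (by positivity)]
    ring_nf
  rw [lintegral_congr_ae this, lintegral_mul_const _ (by fun_prop),
    gamma_laplace (by linarith [hα.2]) (by positivity), ← ENNReal.ofReal_mul (by positivity)]
  ring_nf

theorem gamma_pair_lintegral {α : ℝ} (hα : α ∈ Set.Ioo (0:ℝ) 1) {F : ℝ × ℝ → ℝ≥0∞}
    (hF : Measurable F) :
    ∫⁻ p, F (p.1 + p.2, p.2) ∂((gammaMeasure (1 - α) 1).prod (gammaMeasure α 1))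
      = ∫⁻ x in Ioi 0, ENNReal.ofReal (Real.exp (-x)) *
        ∫⁻ v in Ioo 0 1, ENNReal.ofReal (aslDens α v) * F (x, x * v) := by
  have hp1 := isProbabilityMeasure_gammaMeasure (a := 1 - α) (r := 1) (by linarith [hα.2]) one_pos
  have hp2 := isProbabilityMeasure_gammaMeasure (a := α) (r := 1) hα.1 one_pos
  have hm1 : Measurable (gammaPDF (1 - α) 1) := (measurable_gammaPDFReal _ 1).ennreal_ofReal
  have hm2 : Measurable (gammaPDF α 1) := (measurable_gammaPDFReal _ 1).ennreal_ofReal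
  have hG1 := Real.Gamma_pos_of_pos hα.1
  have hG2 := Real.Gamma_pos_of_pos (show 0 < 1 - α by linarith [hα.2])
  have hGG : Real.sin (α * Real.pi) / Real.pi = (Real.Gamma α * Real.Gamma (1 - α))⁻¹ := by
    rw [Real.Gamma_mul_Gamma_one_sub, inv_div, mul_comm]
  rw [lintegral_prod_symm _ (by fun_prop)]
  calc _ = ∫⁻ b, gammaPDF α 1 b * ∫⁻ a, gammaPDF (1 - α) 1 a * F (a + b, b) := by
        have e : ∀ b, ∫⁻ a, F (a + b, b) ∂(gammaMeasure (1 - α) 1)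
            = ∫⁻ a, gammaPDF (1 - α) 1 a * F (a + b, b) := by
          intro b
          rw [gammaMeasure, lintegral_withDensity_eq_lintegral_mul _ hm1 (by fun_prop)]
          rfl
        simp_rw [e]
        rw [gammaMeasure, lintegral_withDensity_eq_lintegral_mul _ hm2]
        · rfl
        · apply Measurable.lintegral_prod_left'
            (f := fun p : ℝ × ℝ => gammaPDF (1 - α) 1 p.1 * F (p.1 + p.2, p.2))
          fun_prop
    _ = ∫⁻ b, ∫⁻ x, gammaPDF α 1 b * (gammaPDF (1 - α) 1 (x - b) * F (x, b)) := by
        congr 1; ext b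
        rw [← lintegral_const_mul _ (by fun_prop),
          ← lintegral_sub_right_eq_self _ b]
        simp
    _ = ∫⁻ x, ∫⁻ b, gammaPDF α 1 b * (gammaPDF (1 - α) 1 (x - b) * F (x, b)) := by
        rw [lintegral_lintegral_swap]
        apply Measurable.aemeasurable
        unfold Function.uncurry
        fun_prop
    _ = _ := by
        rw [← lintegral_indicator measurableSet_Ioi]
        have : ∀ᵐ x : ℝ, x ≠ 0 := by simp [ae_iff]
        apply lintegral_congr_ae
        filter_upwards [this] with x hx
        rcases lt_or_gt_of_ne hx with hx | hx
        · rw [indicator_of_notMem (by simpa using hx.le)]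
          rw [lintegral_eq_zero_iff (by fun_prop)]
          refine Eventually.of_forall fun b => ?_
          rcases lt_or_ge b 0 with hb | hb
          · simp [gammaPDF_of_neg hb]
          · simp [gammaPDF_of_neg (show x - b < 0 by linarith)]
        · rw [indicator_of_mem (by simpa using hx)]
          conv_lhs => rw [← Real.smul_map_volume_mul_left hx.ne']
          rw [lintegral_smul_measure, lintegral_map (by fun_prop) (by fun_prop),
            ← lintegral_const_mul _ (by unfold aslDens; fun_prop), smul_eq_mul,
            ← lintegral_const_mul _ (by fun_prop),
            ← lintegral_indicator measurableSet_Ioo]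
          have h0 : ∀ᵐ x : ℝ, x ≠ 0 := by simp [ae_iff]
          have h1 : ∀ᵐ x : ℝ, x ≠ 1 := by simp [ae_iff]
          apply lintegral_congr_ae
          filter_upwards [h0, h1] with v hv0 hv1
          rcases lt_or_gt_of_ne hv0 with hv | hv
          · rw [indicator_of_notMem (fun h => by linarith [h.1])]
            rw [gammaPDF_of_neg (by nlinarith)]; simp
          rcases lt_or_gt_of_ne hv1 with hw | hw
          swap
          · rw [indicator_of_notMem (fun h => by linarith [h.2])]
            rw [gammaPDF_of_neg (x := x - x * v) (by nlinarith)]; simp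
          rw [indicator_of_mem (show v ∈ Ioo (0:ℝ) 1 from ⟨hv, hw⟩)]
          have hw' : 0 < 1 - v := by linarith
          have assoc4 : ∀ a b c d : ℝ≥0∞, a * (b * (c * d)) = a * b * c * d := by
            intros; ring
          have assoc3 : ∀ a b c : ℝ≥0∞, a * (b * c) = a * b * c := by
            intros; ring
          rw [show x - x * v = x * (1 - v) by ring, gammaPDF_of_nonneg (by positivity),
            gammaPDF_of_nonneg (by positivity), assoc4, assoc3,
            ← ENNReal.ofReal_mul (by positivity), ← ENNReal.ofReal_mul (by positivity),
            ← ENNReal.ofReal_mul (by positivity)]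
          congr 2
          rw [aslDens, hGG, abs_of_pos hx, Real.mul_rpow hx.le hv.le, Real.mul_rpow hx.le hw'.le]
          have e1 : x ^ (α - 1) * x ^ (1 - α - 1) = x⁻¹ := by
            rw [← Real.rpow_add hx, ← Real.rpow_neg_one]; ring_nf
          have e2 : Real.exp (-(1 * (x * v))) * Real.exp (-(1 * (x * (1 - v)))) = Real.exp (-x) := by
            rw [← Real.exp_add]; ring_nf
          rw [← e2]
          have e3 : x * (x ^ (α - 1) * x ^ (1 - α - 1)) = 1 := by rw [e1]; field_simp
          rw [show (1 - v) ^ (-α) = (1 - v) ^ (1 - α - 1) by ring_nf]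
          generalize x ^ (α - 1) = A at *
          generalize x ^ (1 - α - 1) = B at *
          simp only [Real.one_rpow, mul_inv, one_div]
          linear_combination ((Real.Gamma α)⁻¹ * (Real.Gamma (1 - α))⁻¹ * v ^ (α - 1) *
            (1 - v) ^ (1 - α - 1) * Real.exp (-(1 * (x * v))) *
            Real.exp (-(1 * (x * (1 - v))))) * e3

theorem seq_sup_eq {a : ℕ → ℝ} (ha : Monotone a) (h0 : a 0 = 0) {x : ℝ} (hx : 0 < x)
    (hub : ∃ k, x ≤ a k) (f : ℝ → ℝ≥0∞) :
    f (⨆ k, if a k < x then a k else 0)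
      = ∑' k, (Ioc (a k) (a (k + 1))).indicator (fun _ => f (a k)) x := by
  obtain ⟨k, hk1, hk2⟩ : ∃ k, a k < x ∧ x ≤ a (k + 1) := by
    have hs := Nat.find_spec hub
    have hm := fun m => Nat.find_min (m := m) hub
    rcases h : Nat.find hub with _ | j
    · rw [h] at hs; linarith
    · rw [h] at hs
      exact ⟨j, not_le.1 (hm j (by omega)), hs⟩
  have hnn : ∀ j, 0 ≤ a j := fun j => h0 ▸ ha (Nat.zero_le j)
  have hle : ∀ i, a i < x → a i ≤ a k := by
    intro i hi
    by_contra hc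
    have : k + 1 ≤ i := by
      by_contra h'
      exact hc (ha (by omega))
    linarith [ha this]
  have hb : ∀ i, (if a i < x then a i else 0) ≤ a k := by
    intro i
    split_ifs with h
    · exact hle i h
    · exact hnn k
  have hsup : (⨆ k, if a k < x then a k else 0) = a k := by
    apply le_antisymm
    · exact ciSup_le hb
    · have := le_ciSup (f := fun k => if a k < x then a k else 0) ⟨a k, by rintro _ ⟨i, rfl⟩; exact hb i⟩ k
      simpa [hk1] using this
  rw [hsup, tsum_eq_single k]
  · rw [indicator_of_mem (show x ∈ Ioc (a k) (a (k + 1)) from ⟨hk1, hk2⟩)]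
  · intro i hi
    rw [indicator_of_notMem]
    rintro ⟨h1, h2⟩
    rcases lt_or_gt_of_ne hi with h | h
    · linarith [ha (show i + 1 ≤ k by omega)]
    · linarith [ha (show k + 1 ≤ i by omega)]

theorem lintegral_exp_Ioc {lam a b : ℝ} (hl : 0 < lam) (hab : a ≤ b) :
    ∫⁻ x in Ioc a b, ENNReal.ofReal (Real.exp (-(lam * x)))
      = ENNReal.ofReal ((Real.exp (-(lam * a)) - Real.exp (-(lam * b))) / lam) := by
  rw [← ofReal_integral_eq_lintegral_ofReal]
  · congr 1
    rw [← intervalIntegral.integral_of_le hab]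
    have : ∀ x ∈ uIcc a b, HasDerivAt (fun x => -(Real.exp (-(lam * x)) / lam))
        (Real.exp (-(lam * x))) x := by
      intro x _
      have h1 : HasDerivAt (fun x => -(lam * x)) (-(lam * 1)) x :=
        ((hasDerivAt_id x).const_mul lam).neg
      have h2 := (h1.exp.div_const lam).neg
      have h3 : -(Real.exp (-(lam * x)) * -(lam * 1) / lam) = Real.exp (-(lam * x)) := by
        field_simp
      rw [h3] at h2
      exact h2
    rw [intervalIntegral.integral_eq_sub_of_hasDerivAt this
      (Continuous.intervalIntegrable (by fun_prop) _ _)]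
    ring
  · exact (Continuous.integrableOn_Ioc (by fun_prop))
  · exact Eventually.of_forall fun x => (Real.exp_pos _).le

/-- Discretised undershoot. -/
noncomputable def dn {Ω : Type*} (V : ℝ → Ω → ℝ) (n : ℕ) (x : ℝ) (ω : Ω) : ℝ :=
  ⨆ k : ℕ, if V ((k : ℝ) / 2 ^ n) ω < x then V ((k : ℝ) / 2 ^ n) ω else 0

/-- Undershoot through the dyadic times. -/
noncomputable def dp {Ω : Type*} (V : ℝ → Ω → ℝ) (x : ℝ) (ω : Ω) : ℝ :=
  ⨆ n : ℕ, dn V n x ω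

theorem measurable_dn {Ω : Type*} [MeasurableSpace Ω] {V : ℝ → Ω → ℝ}
    (hVmeas : ∀ t, Measurable (V t)) (n : ℕ) :
    Measurable (fun p : ℝ × Ω => dn V n p.1 p.2) := by
  unfold dn
  refine Measurable.iSup fun k => ?_
  have h : Measurable (fun p : ℝ × Ω => V ((k : ℝ) / 2 ^ n) p.2) :=
    (hVmeas ((k : ℝ) / 2 ^ n)).comp measurable_snd
  exact Measurable.ite (measurableSet_lt h measurable_fst) h measurable_const

theorem measurable_dp {Ω : Type*} [MeasurableSpace Ω] {V : ℝ → Ω → ℝ}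
    (hVmeas : ∀ t, Measurable (V t)) :
    Measurable (fun p : ℝ × Ω => dp V p.1 p.2) := by
  unfold dp
  exact Measurable.iSup fun n => measurable_dn hVmeas n

section paths
variable {Ω : Type*} {V : ℝ → Ω → ℝ} {ω : Ω} {x : ℝ}

theorem dn_bdd (hx : 0 < x) (n : ℕ) (k : ℕ) :
    (if V ((k : ℝ) / 2 ^ n) ω < x then V ((k : ℝ) / 2 ^ n) ω else 0) ≤ x := by
  split_ifs with h
  · exact h.le
  · exact hx.le

theorem dn_le (hx : 0 < x) (n : ℕ) : dn V n x ω ≤ x := ciSup_le (dn_bdd hx n)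

theorem le_dn (hx : 0 < x) (n k : ℕ) (h : V ((k : ℝ) / 2 ^ n) ω < x) :
    V ((k : ℝ) / 2 ^ n) ω ≤ dn V n x ω := by
  have := le_ciSup (f := fun k : ℕ => if V ((k : ℝ) / 2 ^ n) ω < x then V ((k : ℝ) / 2 ^ n) ω else 0)
    ⟨x, by rintro _ ⟨i, rfl⟩; exact dn_bdd hx n i⟩ k
  rw [if_pos h] at this
  exact this

theorem dp_le (hx : 0 < x) : dp V x ω ≤ x := ciSup_le (dn_le hx)

theorem dn_le_dp (hx : 0 < x) (n : ℕ) : dn V n x ω ≤ dp V x ω :=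
  le_ciSup (f := fun n => dn V n x ω) ⟨x, by rintro _ ⟨i, rfl⟩; exact dn_le hx i⟩ n

theorem dn_nonneg (h0 : V 0 ω = 0) (hx : 0 < x) (n : ℕ) : 0 ≤ dn V n x ω := by
  have := le_dn (V := V) (ω := ω) hx n 0 (by simpa [h0] using hx)
  simpa [h0] using this

theorem dp_nonneg (h0 : V 0 ω = 0) (hx : 0 < x) : 0 ≤ dp V x ω :=
  (dn_nonneg h0 hx 0).trans (dn_le_dp hx 0)

theorem dn_mono (h0 : V 0 ω = 0) (hx : 0 < x) : Monotone (fun n => dn V n x ω) := by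
  apply monotone_nat_of_le_succ
  intro n
  refine ciSup_le fun k => ?_
  split_ifs with h
  · have e : (k : ℝ) / 2 ^ n = ((2 * k : ℕ) : ℝ) / 2 ^ (n + 1) := by
      push_cast; field_simp; ring
    rw [e] at h ⊢
    exact le_dn hx _ _ h
  · exact dn_nonneg h0 hx _

theorem dn_tendsto (h0 : V 0 ω = 0) (hx : 0 < x) :
    Tendsto (fun n => dn V n x ω) atTop (nhds (dp V x ω)) :=
  tendsto_atTop_ciSup (dn_mono h0 hx) ⟨x, by rintro _ ⟨i, rfl⟩; exact dn_le hx i⟩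

theorem le_dp (hmono : MonotoneOn (fun t => V t ω) (Set.Ici 0))
    (hrc : ∀ t : ℝ, 0 ≤ t →
      Tendsto (fun s => V s ω) (nhdsWithin t (Set.Ioi t)) (nhds (V t ω)))
    (hx : 0 < x) {s : ℝ} (hs : 0 ≤ s) (h : V s ω < x) : V s ω ≤ dp V x ω := by
  have h1 : ∀ᶠ t in nhdsWithin s (Set.Ioi s), V t ω < x := (hrc s hs).eventually_lt_const h
  obtain ⟨t, ht, ht'⟩ := (mem_nhdsGT_iff_exists_Ioo_subset).1 h1
  have ht0 : s < t := ht
  obtain ⟨n, hn⟩ := exists_pow_lt_of_lt_one (show 0 < t - s by linarith)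
    (show (1 / 2 : ℝ) < 1 by norm_num)
  have h2 : (0:ℝ) < 2 ^ n := by positivity
  have hn' : 1 / 2 ^ n < t - s := by simpa [one_div] using hn
  set k := ⌊s * 2 ^ n⌋₊ + 1
  have hk1 : s < (k : ℝ) / 2 ^ n := by
    rw [lt_div_iff₀ h2]
    push_cast [k]
    exact Nat.lt_floor_add_one _
  have hk2 : (k : ℝ) / 2 ^ n < t := by
    have : (k : ℝ) / 2 ^ n ≤ s + 1 / 2 ^ n := by
      rw [div_le_iff₀ h2]
      push_cast [k]
      have := Nat.floor_le (show 0 ≤ s * 2 ^ n by positivity)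
      field_simp
      linarith
    linarith
  have h3 : V ((k : ℝ) / 2 ^ n) ω < x := ht' ⟨hk1, hk2⟩
  calc V s ω ≤ V ((k : ℝ) / 2 ^ n) ω := hmono hs (mem_Ici.2 (by positivity)) hk1.le
    _ ≤ dn V n x ω := le_dn hx n k h3
    _ ≤ _ := dn_le_dp hx n

theorem under_le_dp (h0 : V 0 ω = 0) (hmono : MonotoneOn (fun t => V t ω) (Set.Ici 0))
    (hrc : ∀ t : ℝ, 0 ≤ t →
      Tendsto (fun s => V s ω) (nhdsWithin t (Set.Ioi t)) (nhds (V t ω)))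
    (hx : 0 < x) {y : ℝ} (hy : x < y) :
    sSup ((fun s => V s ω) '' Set.Ico 0 (sInf {t : ℝ | 0 ≤ t ∧ x < V t ω})) ≤ dp V y ω := by
  apply Real.sSup_le
  · rintro _ ⟨s, ⟨hs0, hs⟩, rfl⟩
    have : V s ω ≤ x := by
      by_contra hc
      have : sInf {t : ℝ | 0 ≤ t ∧ x < V t ω} ≤ s :=
        csInf_le ⟨0, fun t ht => ht.1⟩ ⟨hs0, not_le.1 hc⟩
      linarith
    exact le_dp hmono hrc (hx.trans hy) hs0 (by linarith)
  · exact dp_nonneg h0 (hx.trans hy)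

theorem dp_le_under (h0 : V 0 ω = 0) (hmono : MonotoneOn (fun t => V t ω) (Set.Ici 0))
    (hrc : ∀ t : ℝ, 0 ≤ t →
      Tendsto (fun s => V s ω) (nhdsWithin t (Set.Ioi t)) (nhds (V t ω)))
    (hub : ∃ t : ℝ, 0 ≤ t ∧ x < V t ω) {y : ℝ} (hy : y < x) :
    dp V y ω ≤
    sSup ((fun s => V s ω) '' Set.Ico 0 (sInf {t : ℝ | 0 ≤ t ∧ x < V t ω})) := by
  refine ciSup_le fun n => ciSup_le fun k => ?_
  have hbdd : BddAbove ((fun s => V s ω) '' Set.Ico 0 (sInf {t : ℝ | 0 ≤ t ∧ x < V t ω})) := by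
    refine ⟨x, ?_⟩
    rintro _ ⟨s, ⟨hs0, hs⟩, rfl⟩
    by_contra hc
    have : sInf {t : ℝ | 0 ≤ t ∧ x < V t ω} ≤ s :=
      csInf_le ⟨0, fun t ht => ht.1⟩ ⟨hs0, not_le.1 hc⟩
    linarith
  split_ifs with h
  · set s := (k : ℝ) / 2 ^ n
    have hs : 0 ≤ s := by positivity
    apply le_csSup hbdd
    refine ⟨s, ⟨hs, ?_⟩, rfl⟩
    have h1 : ∀ᶠ t in nhdsWithin s (Set.Ioi s), V t ω < x :=
      (hrc s hs).eventually_lt_const (h.trans hy)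
    obtain ⟨t, ht, ht'⟩ := (mem_nhdsGT_iff_exists_Ioo_subset).1 h1
    have ht0 : s < t := ht
    refine lt_of_lt_of_le ht0 (le_csInf hub ?_)
    rintro r ⟨hr0, hr⟩
    by_contra hc
    rcases le_or_gt r s with h' | h'
    · have : V r ω ≤ V s ω := hmono hr0 hs h'
      linarith
    · have : V r ω < x := ht' ⟨h', not_le.1 hc⟩
      linarith
  · apply Real.sSup_nonneg
    rintro _ ⟨s, ⟨hs0, hs⟩, rfl⟩
    have : V 0 ω ≤ V s ω := hmono (mem_Ici.2 le_rfl) hs0 hs0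
    simpa [h0] using this
end paths

section laplace
variable {Ω : Type*} [MeasurableSpace Ω] {μ : Measure Ω} [IsProbabilityMeasure μ]
    {α c : ℝ} {V : ℝ → Ω → ℝ}

theorem lintegral_laplace
    (hVlaplace : ∀ t : ℝ, 0 ≤ t → ∀ lam : ℝ, 0 ≤ lam →
      (∫ ω, Real.exp (-(lam * V t ω)) ∂μ) = Real.exp (-(t * c * lam ^ α)))
    {t lam : ℝ} (ht : 0 ≤ t) (hl : 0 ≤ lam) :
    ∫⁻ ω, ENNReal.ofReal (Real.exp (-(lam * V t ω))) ∂μ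
      = ENNReal.ofReal (Real.exp (-(t * c * lam ^ α))) := by
  have h := hVlaplace t ht lam hl
  rw [← ofReal_integral_eq_lintegral_ofReal, h]
  · apply Integrable.of_integral_ne_zero
    rw [h]; exact (Real.exp_pos _).ne'
  · exact Eventually.of_forall fun x => (Real.exp_pos _).le

theorem ae_unbounded (hc : 0 < c) (hVmeas : ∀ t, Measurable (V t))
    (hVlaplace : ∀ t : ℝ, 0 ≤ t → ∀ lam : ℝ, 0 ≤ lam →
      (∫ ω, Real.exp (-(lam * V t ω)) ∂μ) = Real.exp (-(t * c * lam ^ α))) :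
    ∀ᵐ ω ∂μ, ∀ x : ℝ, ∃ n : ℕ, x < V n ω := by
  have h0 : ∫⁻ ω, (⨅ n : ℕ, ENNReal.ofReal (Real.exp (-(1 * V n ω)))) ∂μ = 0 := by
    have hle : ∀ n : ℕ, ∫⁻ ω, (⨅ n : ℕ, ENNReal.ofReal (Real.exp (-(1 * V n ω)))) ∂μ
        ≤ ENNReal.ofReal (Real.exp (-(n * c))) := by
      intro n
      calc _ ≤ ∫⁻ ω, ENNReal.ofReal (Real.exp (-(1 * V n ω))) ∂μ :=
            lintegral_mono fun ω => iInf_le _ n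
        _ = _ := by
            rw [lintegral_laplace hVlaplace (by positivity) zero_le_one]; simp
    have hlim : Tendsto (fun n : ℕ => ENNReal.ofReal (Real.exp (-(n * c)))) atTop (nhds 0) := by
      rw [← ENNReal.ofReal_zero]
      apply ENNReal.tendsto_ofReal
      apply Real.tendsto_exp_atBot.comp
      apply tendsto_neg_atTop_atBot.comp
      exact tendsto_natCast_atTop_atTop.atTop_mul_const hc
    exact le_antisymm (ge_of_tendsto' hlim hle) zero_le
  rw [lintegral_eq_zero_iff] at h0
  · filter_upwards [h0] with ω hω x
    have : (⨅ n : ℕ, ENNReal.ofReal (Real.exp (-(1 * V n ω)))) < ENNReal.ofReal (Real.exp (-x)) := by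
      simp only [Pi.zero_apply] at hω
      rw [hω]
      simpa using Real.exp_pos _
    obtain ⟨n, hn⟩ := iInf_lt_iff.1 this
    refine ⟨n, ?_⟩
    rw [ENNReal.ofReal_lt_ofReal_iff (Real.exp_pos _), Real.exp_lt_exp] at hn
    linarith
  · exact Measurable.iInf fun n => by have := hVmeas n; fun_prop

theorem laplace_step (hVmeas : ∀ t, Measurable (V t))
    (hVmono : ∀ ω, MonotoneOn (fun t => V t ω) (Set.Ici 0))
    (hVindep : ∀ s t : ℝ, 0 ≤ s → 0 ≤ t →
      Indep (⨆ u ∈ Set.Icc (0:ℝ) t, MeasurableSpace.comap (V u) inferInstance)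
        (MeasurableSpace.comap (fun ω => V (t + s) ω - V t ω) inferInstance) μ)
    (hVstat : ∀ s t : ℝ, 0 ≤ s → 0 ≤ t →
      Measure.map (fun ω => V (t + s) ω - V t ω) μ = Measure.map (V s) μ)
    (hVlaplace : ∀ t : ℝ, 0 ≤ t → ∀ lam : ℝ, 0 ≤ lam →
      (∫ ω, Real.exp (-(lam * V t ω)) ∂μ) = Real.exp (-(t * c * lam ^ α)))
    {lam th s t : ℝ} (hl : 0 < lam) (hth : 0 ≤ th) (hs : 0 ≤ s) (ht : 0 ≤ t) :
    ∫⁻ ω, ENNReal.ofReal (Real.exp (-(th * V t ω))) *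
        ENNReal.ofReal ((Real.exp (-(lam * V t ω)) - Real.exp (-(lam * V (t + s) ω))) / lam) ∂μ
      = ENNReal.ofReal (Real.exp (-(t * c * (lam + th) ^ α)) *
          ((1 - Real.exp (-(s * c * lam ^ α))) / lam)) := by
  have hind : IndepFun (V t) (fun ω => V (t + s) ω - V t ω) μ := by
    rw [IndepFun_iff_Indep]
    refine indep_of_indep_of_le_left (hVindep s t hs ht) ?_
    exact le_iSup₂_of_le (f := fun (u : ℝ) (_ : u ∈ Set.Icc (0:ℝ) t) =>
      MeasurableSpace.comap (V u) inferInstance) t ⟨ht, le_rfl⟩ le_rfl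
  have hmt := hVmeas t
  have hmts := hVmeas (t + s)
  have hms := hVmeas s
  have e1 : ∀ ω, ENNReal.ofReal (Real.exp (-(th * V t ω))) *
        ENNReal.ofReal ((Real.exp (-(lam * V t ω)) - Real.exp (-(lam * V (t + s) ω))) / lam)
      = ENNReal.ofReal (Real.exp (-((lam + th) * V t ω))) *
        ENNReal.ofReal ((1 - Real.exp (-(lam * (V (t + s) ω - V t ω)))) / lam) := by
    intro ω
    rw [← ENNReal.ofReal_mul (Real.exp_pos _).le, ← ENNReal.ofReal_mul (Real.exp_pos _).le]
    congr 1
    have a1 : Real.exp (-((lam + th) * V t ω))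
      = Real.exp (-(th * V t ω)) * Real.exp (-(lam * V t ω)) := by
      rw [← Real.exp_add]; ring_nf
    have a2 : Real.exp (-(lam * V (t + s) ω))
      = Real.exp (-(lam * V t ω)) * Real.exp (-(lam * (V (t + s) ω - V t ω))) := by
      rw [← Real.exp_add]; ring_nf
    rw [a1, a2]; ring
  simp_rw [e1]
  have hind2 : IndepFun (fun ω => ENNReal.ofReal (Real.exp (-((lam + th) * V t ω))))
      (fun ω => ENNReal.ofReal ((1 - Real.exp (-(lam * (V (t + s) ω - V t ω)))) / lam)) μ :=
    hind.comp (φ := fun v => ENNReal.ofReal (Real.exp (-((lam + th) * v))))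
      (ψ := fun v => ENNReal.ofReal ((1 - Real.exp (-(lam * v))) / lam))
      (by fun_prop) (by fun_prop)
  have := lintegral_mul_eq_lintegral_mul_lintegral_of_indepFun (μ := μ) (by fun_prop) (by fun_prop)
    hind2
  simp only [Pi.mul_apply] at this
  rw [this, lintegral_laplace hVlaplace ht (by positivity), ENNReal.ofReal_mul (Real.exp_pos _).le]
  congr 1
  have hval : ∫ ω, Real.exp (-(lam * (V (t + s) ω - V t ω))) ∂μ
      = Real.exp (-(s * c * lam ^ α)) := by
    rw [← hVlaplace s hs lam hl.le]
    have h1 := integral_map (μ := μ) (φ := fun ω => V (t + s) ω - V t ω)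
      (f := fun v => Real.exp (-(lam * v))) (by fun_prop)
      (Continuous.aestronglyMeasurable (by fun_prop))
    have h2 := integral_map (μ := μ) (φ := V s)
      (f := fun v => Real.exp (-(lam * v))) (by fun_prop)
      (Continuous.aestronglyMeasurable (by fun_prop))
    rw [← h1, ← h2, hVstat s t hs ht]
  have hInteg : Integrable (fun ω => Real.exp (-(lam * (V (t + s) ω - V t ω)))) μ := by
    apply Integrable.of_integral_ne_zero
    rw [hval]; exact (Real.exp_pos _).ne'
  rw [← ofReal_integral_eq_lintegral_ofReal]
  · rw [integral_div, integral_sub (integrable_const _) hInteg, hval]; simp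
  · exact ((integrable_const _).sub hInteg).div_const _
  · refine Eventually.of_forall fun ω => ?_
    have : V t ω ≤ V (t + s) ω := hVmono ω ht (mem_Ici.2 (by positivity)) (by linarith)
    have h2 : Real.exp (-(lam * (V (t + s) ω - V t ω))) ≤ 1 := by
      apply Real.exp_le_one_iff.2
      have := mul_nonneg hl.le (sub_nonneg.2 this)
      linarith
    exact div_nonneg (by linarith) hl.le

theorem laplace_dn (hc : 0 < c) (hVmeas : ∀ t, Measurable (V t))
    (hV0 : ∀ ω, V 0 ω = 0)
    (hVmono : ∀ ω, MonotoneOn (fun t => V t ω) (Set.Ici 0))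
    (hVindep : ∀ s t : ℝ, 0 ≤ s → 0 ≤ t →
      Indep (⨆ u ∈ Set.Icc (0:ℝ) t, MeasurableSpace.comap (V u) inferInstance)
        (MeasurableSpace.comap (fun ω => V (t + s) ω - V t ω) inferInstance) μ)
    (hVstat : ∀ s t : ℝ, 0 ≤ s → 0 ≤ t →
      Measure.map (fun ω => V (t + s) ω - V t ω) μ = Measure.map (V s) μ)
    (hVlaplace : ∀ t : ℝ, 0 ≤ t → ∀ lam : ℝ, 0 ≤ lam →
      (∫ ω, Real.exp (-(lam * V t ω)) ∂μ) = Real.exp (-(t * c * lam ^ α)))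
    {lam th : ℝ} (hl : 0 < lam) (hth : 0 ≤ th) (n : ℕ) :
    ∫⁻ p, ENNReal.ofReal (Real.exp (-(lam * p.1))) *
        ENNReal.ofReal (Real.exp (-(th * dn V n p.1 p.2))) ∂((volume.restrict (Ioi 0)).prod μ)
      = ENNReal.ofReal ((1 - Real.exp (-((1 / 2 ^ n) * c * lam ^ α))) /
          (1 - Real.exp (-((1 / 2 ^ n) * c * (lam + th) ^ α))) / lam) := by
  set h : ℝ := 1 / 2 ^ n with hh
  have hhpos : 0 < h := by positivity
  have hmd := measurable_dn hVmeas n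
  rw [lintegral_prod_symm _ (by fun_prop)]
  have key : ∀ᵐ ω ∂μ, ∫⁻ x in Ioi 0, ENNReal.ofReal (Real.exp (-(lam * x))) *
        ENNReal.ofReal (Real.exp (-(th * dn V n x ω)))
      = ∑' k : ℕ, ENNReal.ofReal (Real.exp (-(th * V (k * h) ω))) *
        ENNReal.ofReal ((Real.exp (-(lam * V (k * h) ω)) -
          Real.exp (-(lam * V (k * h + h) ω))) / lam) := by
    filter_upwards [ae_unbounded hc hVmeas hVlaplace] with ω hω
    let a : ℕ → ℝ := fun k => V (k * h) ω
    have ha : Monotone a := by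
      intro i j hij
      refine hVmono ω (mem_Ici.2 (by positivity)) (mem_Ici.2 (by positivity)) ?_
      have : (i : ℝ) ≤ j := by exact_mod_cast hij
      gcongr
    have ha0 : a 0 = 0 := by simp [a, hV0]
    have hann : ∀ k, 0 ≤ a k := fun k => ha0 ▸ ha (Nat.zero_le k)
    have hub : ∀ x, ∃ k, x ≤ a k := by
      intro x
      obtain ⟨m, hm⟩ := hω x
      refine ⟨m * 2 ^ n, ?_⟩
      have : ((m * 2 ^ n : ℕ) : ℝ) * h = m := by
        rw [hh]; push_cast; field_simp
      simp only [a, this]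
      exact hm.le
    have hsucc : ∀ k : ℕ, a (k + 1) = V (k * h + h) ω := by
      intro k
      simp only [a]; push_cast; ring_nf
    have e1 : ∀ x ∈ Ioi (0:ℝ), ENNReal.ofReal (Real.exp (-(lam * x))) *
        ENNReal.ofReal (Real.exp (-(th * dn V n x ω)))
        = ∑' k : ℕ, (Ioc (a k) (a (k + 1))).indicator (fun x =>
          ENNReal.ofReal (Real.exp (-(th * a k))) * ENNReal.ofReal (Real.exp (-(lam * x)))) x := by
      intro x hx
      have : dn V n x ω = ⨆ k, if a k < x then a k else 0 := by
        unfold dn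
        simp only [a, hh, mul_one_div]
      rw [this, seq_sup_eq ha ha0 hx (hub x) (fun v => ENNReal.ofReal (Real.exp (-(th * v)))),
        ← ENNReal.tsum_mul_left]
      congr 1; ext k
      by_cases hk : x ∈ Ioc (a k) (a (k + 1))
      · simp only [indicator_of_mem hk]; rw [mul_comm]
      · simp only [indicator_of_notMem hk, mul_zero]
    rw [setLIntegral_congr_fun measurableSet_Ioi e1, lintegral_tsum]
    · congr 1; ext k
      rw [← hsucc]
      change _ = ENNReal.ofReal (Real.exp (-(th * a k))) *
        ENNReal.ofReal ((Real.exp (-(lam * a k)) - Real.exp (-(lam * a (k + 1)))) / lam)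
      have hsub : Ioc (a k) (a (k + 1)) ⊆ Ioi 0 := fun y hy => lt_of_le_of_lt (hann k) hy.1
      rw [lintegral_indicator measurableSet_Ioc, Measure.restrict_restrict measurableSet_Ioc,
        inter_eq_left.2 hsub,
        lintegral_const_mul _ (by fun_prop), lintegral_exp_Ioc hl (ha (Nat.le_succ k))]
    · intro k
      apply Measurable.aemeasurable
      exact Measurable.indicator (by fun_prop) measurableSet_Ioc
  rw [lintegral_congr_ae key, lintegral_tsum]
  · have e2 : ∀ k : ℕ, ∫⁻ ω, ENNReal.ofReal (Real.exp (-(th * V (k * h) ω))) *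
        ENNReal.ofReal ((Real.exp (-(lam * V (k * h) ω)) -
          Real.exp (-(lam * V (k * h + h) ω))) / lam) ∂μ
        = ENNReal.ofReal (Real.exp (-(h * c * (lam + th) ^ α)) ^ k *
          ((1 - Real.exp (-(h * c * lam ^ α))) / lam)) := by
      intro k
      rw [laplace_step hVmeas hVmono hVindep hVstat hVlaplace hl hth hhpos.le (by positivity),
        ← Real.exp_nat_mul]
      ring_nf
    simp_rw [e2]
    have hlt : Real.exp (-(h * c * (lam + th) ^ α)) < 1 := by
      apply Real.exp_lt_one_iff.2
      have : 0 < lam + th := by linarith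
      have : 0 < h * c * (lam + th) ^ α := by positivity
      linarith
    have hle : Real.exp (-(h * c * lam ^ α)) ≤ 1 := by
      apply Real.exp_le_one_iff.2
      have : 0 < h * c * lam ^ α := by positivity
      linarith
    have hnn : 0 ≤ (1 - Real.exp (-(h * c * lam ^ α))) / lam := div_nonneg (by linarith) hl.le
    rw [← ENNReal.ofReal_tsum_of_nonneg, tsum_mul_right,
      tsum_geometric_of_lt_one (Real.exp_pos _).le hlt]
    · congr 1; ring
    · intro k; positivity
    · exact (summable_geometric_of_lt_one (Real.exp_pos _).le hlt).mul_right _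
  · intro k
    have h1 := hVmeas (k * h)
    have h2 := hVmeas (k * h + h)
    fun_prop

theorem ratio_tendsto {a b : ℝ} (hb : 0 < b) :
    Tendsto (fun n : ℕ => (1 - Real.exp (-((1 / 2 ^ n) * a))) / (1 - Real.exp (-((1 / 2 ^ n) * b))))
      atTop (nhds (a / b)) := by
  have hd : ∀ a : ℝ, Tendsto (fun n : ℕ => (1 - Real.exp (-((1 / 2 ^ n : ℝ) * a))) / (1 / 2 ^ n))
      atTop (nhds a) := by
    intro a
    have h1 : HasDerivAt (fun t : ℝ => 1 - Real.exp (-(t * a))) a 0 := by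
      have h2 : HasDerivAt (fun t : ℝ => -(t * a)) (-(1 * a)) 0 :=
        ((hasDerivAt_id (0:ℝ)).mul_const a).neg
      have := h2.exp.const_sub 1
      simpa using this
    have h3 := h1.tendsto_slope_zero_right
    have h4 : Tendsto (fun n : ℕ => (1 / 2 ^ n : ℝ)) atTop (nhdsWithin 0 (Ioi 0)) := by
      apply tendsto_nhdsWithin_of_tendsto_nhds_of_eventually_within
      · have := tendsto_pow_atTop_nhds_zero_of_lt_one (r := (1 / 2 : ℝ)) (by norm_num) (by norm_num)
        simpa using this
      · exact Eventually.of_forall fun n => by simp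
    refine (h3.comp h4).congr fun n => ?_
    simp [div_eq_inv_mul]
  refine ((hd a).div (hd b) hb.ne').congr fun n => ?_
  have : (1 / 2 ^ n : ℝ) ≠ 0 := by positivity
  simp only [Pi.div_apply]
  rw [div_div_div_cancel_right₀ this]

theorem laplace_dp (hc : 0 < c) (hVmeas : ∀ t, Measurable (V t))
    (hV0 : ∀ ω, V 0 ω = 0)
    (hVmono : ∀ ω, MonotoneOn (fun t => V t ω) (Set.Ici 0))
    (hVindep : ∀ s t : ℝ, 0 ≤ s → 0 ≤ t →
      Indep (⨆ u ∈ Set.Icc (0:ℝ) t, MeasurableSpace.comap (V u) inferInstance)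
        (MeasurableSpace.comap (fun ω => V (t + s) ω - V t ω) inferInstance) μ)
    (hVstat : ∀ s t : ℝ, 0 ≤ s → 0 ≤ t →
      Measure.map (fun ω => V (t + s) ω - V t ω) μ = Measure.map (V s) μ)
    (hVlaplace : ∀ t : ℝ, 0 ≤ t → ∀ lam : ℝ, 0 ≤ lam →
      (∫ ω, Real.exp (-(lam * V t ω)) ∂μ) = Real.exp (-(t * c * lam ^ α)))
    {lam th : ℝ} (hl : 0 < lam) (hth : 0 ≤ th) :
    ∫⁻ p, ENNReal.ofReal (Real.exp (-(lam * p.1))) *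
        ENNReal.ofReal (Real.exp (-(th * dp V p.1 p.2))) ∂((volume.restrict (Ioi 0)).prod μ)
      = ENNReal.ofReal (lam ^ (α - 1) * (lam + th) ^ (-α)) := by
  have hlt : 0 < lam + th := by linarith
  have hpos : ∀ᵐ p ∂((volume.restrict (Ioi (0:ℝ))).prod μ), 0 < p.1 := by
    have h1 : ∀ᵐ x ∂(volume.restrict (Ioi (0:ℝ))), 0 < x := ae_restrict_mem measurableSet_Ioi
    exact Measure.quasiMeasurePreserving_fst.ae h1
  have hT1 : Tendsto (fun n => ∫⁻ p, ENNReal.ofReal (Real.exp (-(lam * p.1))) *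
        ENNReal.ofReal (Real.exp (-(th * dn V n p.1 p.2))) ∂((volume.restrict (Ioi 0)).prod μ))
      atTop (nhds (∫⁻ p, ENNReal.ofReal (Real.exp (-(lam * p.1))) *
        ENNReal.ofReal (Real.exp (-(th * dp V p.1 p.2))) ∂((volume.restrict (Ioi 0)).prod μ))) := by
    apply tendsto_lintegral_of_dominated_convergence
      (fun p => ENNReal.ofReal (Real.exp (-(lam * p.1))) * ENNReal.ofReal (Real.exp (-(0 * dn V 0 p.1 p.2))))
    · intro n
      have := measurable_dn hVmeas n
      fun_prop
    · intro n
      filter_upwards [hpos] with p hp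
      have := dn_nonneg (hV0 p.2) hp n
      have h2 : -(th * dn V n p.1 p.2) ≤ -(0 * dn V 0 p.1 p.2) := by
        linarith [mul_nonneg hth this]
      gcongr ENNReal.ofReal (Real.exp (-(lam * p.1))) * ENNReal.ofReal (Real.exp ?_)
    · rw [laplace_dn hc hVmeas hV0 hVmono hVindep hVstat hVlaplace hl le_rfl]
      exact ENNReal.ofReal_ne_top
    · filter_upwards [hpos] with p hp
      have h1 := dn_tendsto (hV0 p.2) hp
      apply ENNReal.Tendsto.const_mul
      · apply ENNReal.tendsto_ofReal
        exact (Real.continuous_exp.tendsto _).comp (h1.const_mul th).neg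
      · right; exact ENNReal.ofReal_ne_top
  have hT2 : Tendsto (fun n => ∫⁻ p, ENNReal.ofReal (Real.exp (-(lam * p.1))) *
        ENNReal.ofReal (Real.exp (-(th * dn V n p.1 p.2))) ∂((volume.restrict (Ioi 0)).prod μ))
      atTop (nhds (ENNReal.ofReal (lam ^ (α - 1) * (lam + th) ^ (-α)))) := by
    simp_rw [laplace_dn hc hVmeas hV0 hVmono hVindep hVstat hVlaplace hl hth, mul_assoc]
    apply ENNReal.tendsto_ofReal
    have := (ratio_tendsto (a := c * lam ^ α) (b := c * (lam + th) ^ α) (by positivity)).div_const lam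
    convert this using 2
    rw [Real.rpow_sub_one hl.ne', Real.rpow_neg hlt.le, mul_div_mul_left _ _ hc.ne']
    ring
  exact tendsto_nhds_unique hT1 hT2
end laplace

section final
variable {Ω : Type*} [MeasurableSpace Ω] {μ : Measure Ω} [IsProbabilityMeasure μ]
    {α c : ℝ} {V : ℝ → Ω → ℝ}

/-- The standard exponential law. -/
noncomputable def expLaw : Measure ℝ :=
  (volume.restrict (Ioi (0:ℝ))).withDensity (fun x => ENNReal.ofReal (Real.exp (-x)))

instance : IsFiniteMeasure expLaw := by
  unfold expLaw
  exact isFiniteMeasure_withDensity_ofReal (integrableOn_exp_neg_Ioi 0).2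

theorem expLaw_prod (F : ℝ × Ω → ℝ≥0∞) (hF : Measurable F) :
    ∫⁻ p, F p ∂(expLaw.prod μ)
      = ∫⁻ p, ENNReal.ofReal (Real.exp (-p.1)) * F p ∂((volume.restrict (Ioi (0:ℝ))).prod μ) := by
  unfold expLaw
  rw [prod_withDensity_left (by fun_prop),
    lintegral_withDensity_eq_lintegral_mul _ (by fun_prop) hF]
  rfl

theorem ae_fst_pos :
    ∀ᵐ p ∂((volume.restrict (Ioi (0:ℝ))).prod μ), 0 < p.1 := by
  have h1 : ∀ᵐ x ∂(volume.restrict (Ioi (0:ℝ))), 0 < x := ae_restrict_mem measurableSet_Ioi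
  exact Measure.quasiMeasurePreserving_fst.ae h1

theorem joint_law (hα : α ∈ Set.Ioo (0:ℝ) 1) (hc : 0 < c) (hVmeas : ∀ t, Measurable (V t))
    (hV0 : ∀ ω, V 0 ω = 0)
    (hVmono : ∀ ω, MonotoneOn (fun t => V t ω) (Set.Ici 0))
    (hVindep : ∀ s t : ℝ, 0 ≤ s → 0 ≤ t →
      Indep (⨆ u ∈ Set.Icc (0:ℝ) t, MeasurableSpace.comap (V u) inferInstance)
        (MeasurableSpace.comap (fun ω => V (t + s) ω - V t ω) inferInstance) μ)
    (hVstat : ∀ s t : ℝ, 0 ≤ s → 0 ≤ t →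
      Measure.map (fun ω => V (t + s) ω - V t ω) μ = Measure.map (V s) μ)
    (hVlaplace : ∀ t : ℝ, 0 ≤ t → ∀ lam : ℝ, 0 ≤ lam →
      (∫ ω, Real.exp (-(lam * V t ω)) ∂μ) = Real.exp (-(t * c * lam ^ α)))
    {F : ℝ × ℝ → ℝ≥0∞} (hF : Measurable F) :
    ∫⁻ x in Ioi 0, ENNReal.ofReal (Real.exp (-x)) * ∫⁻ ω, F (x, dp V x ω) ∂μ
      = ∫⁻ x in Ioi 0, ENNReal.ofReal (Real.exp (-x)) *
        ∫⁻ v in Ioo 0 1, ENNReal.ofReal (aslDens α v) * F (x, x * v) := by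
  have hp1 := isProbabilityMeasure_gammaMeasure (a := 1 - α) (r := 1) (by linarith [hα.2]) one_pos
  have hp2 := isProbabilityMeasure_gammaMeasure (a := α) (r := 1) hα.1 one_pos
  have hmd := measurable_dp hVmeas
  have hM : (expLaw.prod μ).map (fun p => (p.1.toNNReal, (dp V p.1 p.2).toNNReal))
      = ((gammaMeasure (1 - α) 1).prod (gammaMeasure α 1)).map
        (fun p => ((p.1 + p.2).toNNReal, p.2.toNNReal)) := by
    apply laplace_ext_quadrant
    intro m n
    rw [gamma_pair_laplace hα, lintegral_map (by fun_prop) (by fun_prop),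
      expLaw_prod _ (by fun_prop)]
    rw [← laplace_dp hc hVmeas hV0 hVmono hVindep hVstat hVlaplace (by positivity) (by positivity)]
    apply lintegral_congr_ae
    filter_upwards [ae_fst_pos] with p hp
    have := dp_nonneg (hV0 p.2) hp
    rw [← ENNReal.ofReal_mul (Real.exp_pos _).le, ← ENNReal.ofReal_mul (Real.exp_pos _).le,
      ← Real.exp_add, ← Real.exp_add, Real.coe_toNNReal _ hp.le, Real.coe_toNNReal _ this]
    ring_nf
  have hI : ∫⁻ z : ℝ≥0 × ℝ≥0, F ((z.1 : ℝ), (z.2 : ℝ)) ∂((expLaw.prod μ).map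
        (fun p => (p.1.toNNReal, (dp V p.1 p.2).toNNReal)))
      = ∫⁻ z : ℝ≥0 × ℝ≥0, F ((z.1 : ℝ), (z.2 : ℝ)) ∂(((gammaMeasure (1 - α) 1).prod (gammaMeasure α 1)).map
        (fun p => ((p.1 + p.2).toNNReal, p.2.toNNReal))) := by rw [hM]
  rw [lintegral_map (by fun_prop) (by fun_prop), lintegral_map (by fun_prop) (by fun_prop),
    expLaw_prod _ (by fun_prop)] at hI
  have e1 : ∫⁻ p, F (((p.1 + p.2).toNNReal : ℝ), (p.2.toNNReal : ℝ))
        ∂((gammaMeasure (1 - α) 1).prod (gammaMeasure α 1))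
      = ∫⁻ p, F (p.1 + p.2, p.2) ∂((gammaMeasure (1 - α) 1).prod (gammaMeasure α 1)) := by
    apply lintegral_congr_ae
    have h1 : ∀ᵐ p ∂((gammaMeasure (1 - α) 1).prod (gammaMeasure α 1)), 0 < p.1 :=
      Measure.quasiMeasurePreserving_fst.ae gamma_ae_pos
    have h2 : ∀ᵐ p ∂((gammaMeasure (1 - α) 1).prod (gammaMeasure α 1)), 0 < p.2 :=
      Measure.quasiMeasurePreserving_snd.ae gamma_ae_pos
    filter_upwards [h1, h2] with p hp hp'
    rw [Real.coe_toNNReal _ (by linarith), Real.coe_toNNReal _ hp'.le]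
  rw [e1, gamma_pair_lintegral hα hF] at hI
  rw [← hI, lintegral_prod _ (by fun_prop)]
  apply setLIntegral_congr_fun measurableSet_Ioi
  intro x hx
  have hmx : Measurable (fun ω => dp V x ω) := hmd.comp measurable_prodMk_left
  simp only
  rw [lintegral_const_mul _ (by fun_prop)]
  congr 1
  apply lintegral_congr
  intro ω
  rw [Real.coe_toNNReal _ (le_of_lt hx), Real.coe_toNNReal _ (dp_nonneg (hV0 ω) hx)]

theorem measurable_aslDens : Measurable (aslDens α) := by
  unfold aslDens; fun_prop

theorem ae_law (hα : α ∈ Set.Ioo (0:ℝ) 1) (hc : 0 < c) (hVmeas : ∀ t, Measurable (V t))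
    (hV0 : ∀ ω, V 0 ω = 0)
    (hVmono : ∀ ω, MonotoneOn (fun t => V t ω) (Set.Ici 0))
    (hVindep : ∀ s t : ℝ, 0 ≤ s → 0 ≤ t →
      Indep (⨆ u ∈ Set.Icc (0:ℝ) t, MeasurableSpace.comap (V u) inferInstance)
        (MeasurableSpace.comap (fun ω => V (t + s) ω - V t ω) inferInstance) μ)
    (hVstat : ∀ s t : ℝ, 0 ≤ s → 0 ≤ t →
      Measure.map (fun ω => V (t + s) ω - V t ω) μ = Measure.map (V s) μ)
    (hVlaplace : ∀ t : ℝ, 0 ≤ t → ∀ lam : ℝ, 0 ≤ lam →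
      (∫ ω, Real.exp (-(lam * V t ω)) ∂μ) = Real.exp (-(t * c * lam ^ α)))
    (u : ℝ) :
    ∀ᵐ x ∂(volume.restrict (Ioi (0:ℝ))), μ {ω | dp V x ω ≤ u * x}
      = ∫⁻ v in Ioo 0 1 ∩ Iic u, ENNReal.ofReal (aslDens α v) := by
  have hmd := measurable_dp hVmeas
  have hS : MeasurableSet {q : ℝ × ℝ | q.2 ≤ u * q.1} := measurableSet_le (by fun_prop) (by fun_prop)
  set H : ℝ × ℝ → ℝ≥0∞ := {q : ℝ × ℝ | q.2 ≤ u * q.1}.indicator 1 with hH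
  have hHm : Measurable H := measurable_one.indicator hS
  have hmx : ∀ x, Measurable (fun ω => dp V x ω) := fun x => hmd.comp measurable_prodMk_left
  have hset : ∀ x, MeasurableSet {ω | dp V x ω ≤ u * x} :=
    fun x => measurableSet_le (hmx x) measurable_const
  have e1 : ∀ x, ∫⁻ ω, H (x, dp V x ω) ∂μ = μ {ω | dp V x ω ≤ u * x} := by
    intro x
    rw [← lintegral_indicator_one (hset x)]
    rfl
  have e2 : ∀ x ∈ Ioi (0:ℝ), ∫⁻ v in Ioo 0 1, ENNReal.ofReal (aslDens α v) * H (x, x * v)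
      = ∫⁻ v in Ioo 0 1 ∩ Iic u, ENNReal.ofReal (aslDens α v) := by
    intro x hx
    have hx' : 0 < x := hx
    rw [inter_comm, ← Measure.restrict_restrict measurableSet_Iic,
      ← lintegral_indicator measurableSet_Iic]
    apply lintegral_congr
    intro v
    have : x * v ≤ u * x ↔ v ≤ u := by
      rw [mul_comm u]; exact mul_le_mul_iff_right₀ hx'
    by_cases hv : v ≤ u
    · simp [hH, indicator, this, hv]
    · simp [hH, indicator, this, hv]
  have hfm : Measurable (fun x => μ {ω | dp V x ω ≤ u * x}) := by
    simp_rw [← e1]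
    exact Measurable.lintegral_prod_right' (f := fun p : ℝ × Ω => H (p.1, dp V p.1 p.2))
      (by fun_prop)
  have main : (fun x => ENNReal.ofReal (Real.exp (-x)) * μ {ω | dp V x ω ≤ u * x})
      =ᵐ[volume.restrict (Ioi (0:ℝ))]
      (fun x => ENNReal.ofReal (Real.exp (-x)) *
        ∫⁻ v in Ioo 0 1 ∩ Iic u, ENNReal.ofReal (aslDens α v)) := by
    apply ae_eq_of_forall_setLIntegral_eq_of_sigmaFinite
      (Measurable.mul (by fun_prop) hfm) (by fun_prop)
    intro B hB _
    have hBm : Measurable (B.indicator (1 : ℝ → ℝ≥0∞)) := measurable_one.indicator hB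
    have := joint_law hα hc hVmeas hV0 hVmono hVindep hVstat hVlaplace
      (F := fun q => B.indicator 1 q.1 * H q) (by fun_prop)
    rw [← lintegral_indicator hB, ← lintegral_indicator hB]
    have c1 : ∀ x, B.indicator (fun x => ENNReal.ofReal (Real.exp (-x)) *
        μ {ω | dp V x ω ≤ u * x}) x = ENNReal.ofReal (Real.exp (-x)) *
        ∫⁻ ω, B.indicator 1 x * H (x, dp V x ω) ∂μ := by
      intro x
      have := hmx x
      rw [lintegral_const_mul _ (by fun_prop), e1]
      by_cases hx : x ∈ B <;> simp [hx]
    have c2 : ∀ x ∈ Ioi (0:ℝ), B.indicator (fun x => ENNReal.ofReal (Real.exp (-x)) *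
        ∫⁻ v in Ioo 0 1 ∩ Iic u, ENNReal.ofReal (aslDens α v)) x = ENNReal.ofReal (Real.exp (-x)) *
        ∫⁻ v in Ioo 0 1, ENNReal.ofReal (aslDens α v) * (B.indicator 1 x * H (x, x * v)) := by
      intro x hx
      have hm := measurable_aslDens (α := α)
      have : ∀ v, ENNReal.ofReal (aslDens α v) * (B.indicator 1 x * H (x, x * v))
        = B.indicator 1 x * (ENNReal.ofReal (aslDens α v) * H (x, x * v)) := by
        intro v; ring
      simp_rw [this]
      rw [lintegral_const_mul _ (by fun_prop), e2 x hx]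
      by_cases hx : x ∈ B <;> simp [hx]
    rw [setLIntegral_congr_fun measurableSet_Ioi c2]
    exact (lintegral_congr c1).trans this
  filter_upwards [main] with x hx
  exact (ENNReal.mul_right_inj (by simpa using Real.exp_pos _) ENNReal.ofReal_ne_top).1 hx
end final

/-- Existence of good points in intervals for an almost sure property. -/
theorem exists_mem_Ioo_of_ae {p : ℝ → Prop} (h : ∀ᵐ x ∂(volume.restrict (Ioi (0:ℝ))), p x)
    {a b : ℝ} (ha : 0 ≤ a) (hab : a < b) : ∃ x ∈ Ioo a b, p x := by
  by_contra! hcon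
  rw [ae_restrict_iff' measurableSet_Ioi, ae_iff] at h
  have hsub : Ioo a b ⊆ {x | ¬(x ∈ Ioi (0:ℝ) → p x)} := by
    intro x hx hh
    exact hcon x hx (hh (lt_of_le_of_lt ha hx.1))
  have h1 := measure_mono_null hsub h
  rw [Real.volume_Ioo] at h1
  simp at h1
  linarith

/-- The arcsine law for stable subordinators: if `V` is an `α`-stable subordinator and
`T(x) = inf{t ≥ 0 : V(t) > x}`, then for every `x > 0` the random variable
`V(T(x)-)/x` has the generalised arcsine distribution with parameter `α`.
(The left limit `V(T(x)-)` is written as the supremum of `V` over `[0, T(x))`.) -/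
theorem arcsine_law_stable_subordinator
    {Ω : Type*} [MeasurableSpace Ω] {μ : Measure Ω} [IsProbabilityMeasure μ]
    (α c : ℝ) (hα : α ∈ Set.Ioo (0:ℝ) 1) (hc : 0 < c)
    (V : ℝ → Ω → ℝ)
    (hVmeas : ∀ t, Measurable (V t))
    (hV0 : ∀ ω, V 0 ω = 0)
    (hVmono : ∀ ω, MonotoneOn (fun t => V t ω) (Set.Ici 0))
    (hVrc : ∀ ω, ∀ t : ℝ, 0 ≤ t →
      Tendsto (fun s => V s ω) (nhdsWithin t (Set.Ioi t)) (nhds (V t ω)))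
    -- independent increments: the increment over `[t, t+s]` is independent of the past
    (hVindep : ∀ s t : ℝ, 0 ≤ s → 0 ≤ t →
      Indep (⨆ u ∈ Set.Icc (0:ℝ) t, MeasurableSpace.comap (V u) inferInstance)
        (MeasurableSpace.comap (fun ω => V (t + s) ω - V t ω) inferInstance) μ)
    -- stationary increments
    (hVstat : ∀ s t : ℝ, 0 ≤ s → 0 ≤ t →
      Measure.map (fun ω => V (t + s) ω - V t ω) μ = Measure.map (V s) μ)
    -- α-stability: the Laplace transform
    (hVlaplace : ∀ t : ℝ, 0 ≤ t → ∀ lam : ℝ, 0 ≤ lam →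
      (∫ ω, Real.exp (-(lam * V t ω)) ∂μ) = Real.exp (-(t * c * lam ^ α))) :
    ∀ x : ℝ, 0 < x → ∀ u ∈ Set.Icc (0:ℝ) 1,
      μ {ω | sSup ((fun s => V s ω) ''
          Set.Ico 0 (sInf {t : ℝ | 0 ≤ t ∧ x < V t ω})) ≤ u * x}
        = ENNReal.ofReal (Asl α u) := by
  intro x hx u hu
  have law := ae_law hα hc hVmeas hV0 hVmono hVindep hVstat hVlaplace
  have hub := ae_unbounded hc hVmeas hVlaplace
  have hmd := measurable_aslDens (α := α)
  have hdnn : ∀ v ∈ Ioo (0:ℝ) 1, 0 ≤ aslDens α v := by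
    intro v hv
    have h1 : 0 ≤ Real.sin (α * Real.pi) := by
      apply Real.sin_nonneg_of_nonneg_of_le_pi
      · exact mul_nonneg hα.1.le Real.pi_pos.le
      · nlinarith [Real.pi_pos, hα.2]
    have h2 : 0 ≤ 1 - v := by linarith [hv.2]
    have h3 := hv.1.le
    unfold aslDens
    have := Real.pi_pos
    positivity
  -- total mass
  have hone : ∫⁻ v in Ioo (0:ℝ) 1 ∩ Iic 1, ENNReal.ofReal (aslDens α v) = 1 := by
    obtain ⟨y, hy, hy'⟩ := exists_mem_Ioo_of_ae (law 1) le_rfl one_pos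
    rw [← hy']
    have : {ω | dp V y ω ≤ 1 * y} = univ := by
      ext ω
      simpa using dp_le (V := V) (ω := ω) hy.1
    rw [this, measure_univ]
  have hae : ∀ u : ℝ, 0 ≤ u → u ≤ 1 → (Ioo (0:ℝ) 1 ∩ Iic u : Set ℝ) =ᵐ[volume] Ioc 0 u := by
    intro u hu0 hu1
    have h1 : ∀ᵐ x : ℝ, x ≠ 1 := by simp [ae_iff]
    filter_upwards [h1] with v hv
    apply propext
    change (v ∈ Ioo (0:ℝ) 1 ∩ Iic u) ↔ v ∈ Ioc 0 u
    constructor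
    · rintro ⟨⟨a, _⟩, b⟩
      exact ⟨a, b⟩
    · rintro ⟨a, b⟩
      exact ⟨⟨a, lt_of_le_of_ne (b.trans hu1) hv⟩, b⟩
  have hInteg : IntegrableOn (aslDens α) (Ioc 0 1) := by
    rw [← integrableOn_congr_set_ae (hae 1 zero_le_one le_rfl)]
    refine ⟨hmd.aestronglyMeasurable, ?_⟩
    rw [hasFiniteIntegral_iff_ofReal]
    · rw [hone]; exact ENNReal.one_lt_top
    · rw [EventuallyLE, ae_restrict_iff' (measurableSet_Ioo.inter measurableSet_Iic)]
      exact Eventually.of_forall fun v hv => hdnn v hv.1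
  have hAsl : ∀ u : ℝ, Asl α u = ∫ v in (0:ℝ)..u, aslDens α v := by
    intro u
    unfold Asl aslDens
    rw [intervalIntegral.integral_const_mul]
  have hE : ∀ u ∈ Icc (0:ℝ) 1, ∫⁻ v in Ioo (0:ℝ) 1 ∩ Iic u, ENNReal.ofReal (aslDens α v)
      = ENNReal.ofReal (Asl α u) := by
    intro u hu
    rw [hAsl, intervalIntegral.integral_of_le hu.1,
      ← setIntegral_congr_set (hae u hu.1 hu.2), ofReal_integral_eq_lintegral_ofReal]
    · apply IntegrableOn.congr_set_ae _ (hae u hu.1 hu.2)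
      exact hInteg.mono_set (Ioc_subset_Ioc_right hu.2)
    · rw [EventuallyLE, ae_restrict_iff' (measurableSet_Ioo.inter measurableSet_Iic)]
      exact Eventually.of_forall fun v hv => hdnn v hv.1
  have hcont : ContinuousOn (fun u => ENNReal.ofReal (Asl α u)) (Icc 0 1) := by
    have h1 : IntegrableOn (aslDens α) (uIcc 0 1) := by
      rw [uIcc_of_le zero_le_one, integrableOn_Icc_iff_integrableOn_Ioc]
      exact hInteg
    have h2 := intervalIntegral.continuousOn_primitive_interval h1
    rw [uIcc_of_le zero_le_one, ← funext hAsl] at h2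
    exact ENNReal.continuous_ofReal.comp_continuousOn h2
  have hAsl1 : ENNReal.ofReal (Asl α 1) = 1 := by
    rw [← hE 1 ⟨zero_le_one, le_rfl⟩, hone]
  apply le_antisymm
  · -- upper bound
    rcases hu.2.eq_or_lt with rfl | hu1
    · rw [hAsl1]; exact prob_le_one
    have hle : ∀ w ∈ Ioo u 1, μ {ω | sSup ((fun s => V s ω) ''
          Set.Ico 0 (sInf {t : ℝ | 0 ≤ t ∧ x < V t ω})) ≤ u * x} ≤ ENNReal.ofReal (Asl α w) := by
      intro w hw
      have hw0 : 0 < w := lt_of_le_of_lt hu.1 hw.1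
      have h1 : u * x / w < x := by
        rw [div_lt_iff₀ hw0]; nlinarith [hw.1]
      obtain ⟨y, hy, hy'⟩ := exists_mem_Ioo_of_ae (law w)
        (show 0 ≤ u * x / w from div_nonneg (mul_nonneg hu.1 hx.le) hw0.le) h1
      rw [← hE w ⟨hw0.le, hw.2.le⟩, ← hy']
      apply measure_mono_ae
      filter_upwards [hub] with ω hω hmem
      obtain ⟨n, hn⟩ := hω x
      have h2 := dp_le_under (hV0 ω) (hVmono ω) (hVrc ω) ⟨n, Nat.cast_nonneg n, hn⟩ hy.2
      have h3 : u * x < y * w := (div_lt_iff₀ hw0).1 hy.1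
      have h4 : sSup ((fun s => V s ω) ''
          Set.Ico 0 (sInf {t : ℝ | 0 ≤ t ∧ x < V t ω})) ≤ u * x := hmem
      change dp V y ω ≤ w * y
      linarith
    have hT : Tendsto (fun w => ENNReal.ofReal (Asl α w)) (nhdsWithin u (Ioo u 1))
        (nhds (ENNReal.ofReal (Asl α u))) :=
      (hcont u hu).mono_left (nhdsWithin_mono _ fun w hw => ⟨hu.1.trans hw.1.le, hw.2.le⟩)
    have : (nhdsWithin u (Ioo u 1)).NeBot := by
      rw [nhdsWithin_Ioo_eq_nhdsGT hu1]; infer_instance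
    exact ge_of_tendsto hT (eventually_nhdsWithin_of_forall hle)
  · -- lower bound
    rcases hu.1.eq_or_lt with rfl | hu0
    · simp [Asl]
    have hle : ∀ w ∈ Ioo 0 u, ENNReal.ofReal (Asl α w) ≤ μ {ω | sSup ((fun s => V s ω) ''
          Set.Ico 0 (sInf {t : ℝ | 0 ≤ t ∧ x < V t ω})) ≤ u * x} := by
      intro w hw
      have hw0 : 0 < w := hw.1
      have h1 : x < u * x / w := by
        rw [lt_div_iff₀ hw0]; nlinarith [hw.2]
      obtain ⟨y, hy, hy'⟩ := exists_mem_Ioo_of_ae (law w) hx.le h1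
      rw [← hE w ⟨hw0.le, hw.2.le.trans hu.2⟩, ← hy']
      apply measure_mono
      intro ω hω
      have h2 := under_le_dp (hV0 ω) (hVmono ω) (hVrc ω) hx hy.1
      have h3 : y * w < u * x := (lt_div_iff₀ hw0).1 hy.2
      have h4 : dp V y ω ≤ w * y := hω
      refine h2.trans ?_
      linarith
    have hT : Tendsto (fun w => ENNReal.ofReal (Asl α w)) (nhdsWithin u (Ioo 0 u))
        (nhds (ENNReal.ofReal (Asl α u))) :=
      (hcont u hu).mono_left (nhdsWithin_mono _ fun w hw => ⟨hw.1.le, hw.2.le.trans hu.2⟩)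
    have : (nhdsWithin u (Ioo 0 u)).NeBot := by
      rw [nhdsWithin_Ioo_eq_nhdsLT hu0]; infer_instance
    exact le_of_tendsto hT (eventually_nhdsWithin_of_forall hle)
end

section
/- Jumping over an interval: Let V be an α-stable subordinator (α ∈ (0,1), scale c > 0) and let 0 < a < b. Then the probability that V jumps over the interval [a,b] (i.e. that there is no t ≥ 0 with V(t) ∈ [a,b]) equals P[V(T(b)−) < a] = Asl_α(a/b), where T(b) = inf{t ≥ 0 : V(t) > b}. -/
open MeasureTheory ProbabilityTheory Filter Set
open scoped ENNReal NNReal Classical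

set_option linter.unusedSectionVars false

lemma lap_int (ν : Measure ℝ) (h0 : ν (Iio 0) = 0)
    (hfin : ∫⁻ x, ENNReal.ofReal (Real.exp (-x)) ∂ν ≠ ∞) :
    (∀ᵐ x ∂ν, 0 ≤ x) ∧ Integrable (fun x => Real.exp (-x)) ν ∧
    ∀ f : ℝ → ℝ, Continuous f →
      Integrable (fun x => f (Real.exp (-x)) * Real.exp (-x)) ν := by
  have hpos : ∀ᵐ x ∂ν, 0 ≤ x := by
    rw [ae_iff]; convert h0 using 2; ext x; simp
  have hI : Integrable (fun x => Real.exp (-x)) ν := by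
    refine ⟨by fun_prop, ?_⟩
    rw [hasFiniteIntegral_iff_ofReal (Eventually.of_forall fun x => (Real.exp_pos _).le)]
    exact lt_top_iff_ne_top.2 hfin
  refine ⟨hpos, hI, fun f hf => ?_⟩
  obtain ⟨C, hC⟩ := isCompact_Icc.exists_bound_of_continuousOn (s := Icc (0:ℝ) 1) hf.continuousOn
  refine hI.bdd_mul (c := C) (by fun_prop) ?_
  filter_upwards [hpos] with x hx
  exact hC _ ⟨(Real.exp_pos _).le, Real.exp_le_one_iff.2 (by linarith)⟩

lemma lap_test (ν : ℕ → Measure ℝ) (ν₀ : Measure ℝ)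
    (h0 : ∀ n, ν n (Iio 0) = 0) (h00 : ν₀ (Iio 0) = 0)
    (hfin : ∀ n, ∫⁻ x, ENNReal.ofReal (Real.exp (-x)) ∂ν n ≠ ∞)
    (hfin0 : ∫⁻ x, ENNReal.ofReal (Real.exp (-x)) ∂ν₀ ≠ ∞)
    (hconv : ∀ j : ℕ, Tendsto (fun n => ∫⁻ x, ENNReal.ofReal (Real.exp (-(((j:ℝ)+1)*x))) ∂ν n)
      atTop (nhds (∫⁻ x, ENNReal.ofReal (Real.exp (-(((j:ℝ)+1)*x))) ∂ν₀)))
    (f : ℝ → ℝ) (hf : Continuous f) :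
    Tendsto (fun n => ∫ x, f (Real.exp (-x)) * Real.exp (-x) ∂ν n) atTop
      (nhds (∫ x, f (Real.exp (-x)) * Real.exp (-x) ∂ν₀)) := by
  have key : ∀ m : Measure ℝ, ∀ j : ℕ, ∫ x, (Real.exp (-x)) ^ j * Real.exp (-x) ∂m =
      (∫⁻ x, ENNReal.ofReal (Real.exp (-(((j:ℝ)+1)*x))) ∂m).toReal := by
    intro m j
    rw [integral_eq_lintegral_of_nonneg_ae (Eventually.of_forall fun x => by positivity)
      (by fun_prop)]
    congr 1
    refine lintegral_congr fun x => ?_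
    rw [← Real.exp_nat_mul, ← Real.exp_add]
    congr 2; ring
  have hmon : ∀ j : ℕ, Tendsto (fun n => ∫ x, (Real.exp (-x)) ^ j * Real.exp (-x) ∂ν n) atTop
      (nhds (∫ x, (Real.exp (-x)) ^ j * Real.exp (-x) ∂ν₀)) := by
    intro j
    simp only [key]
    refine (ENNReal.tendsto_toReal ?_).comp (hconv j)
    refine ne_top_of_le_ne_top hfin0 (lintegral_mono_ae ?_)
    filter_upwards [(lap_int ν₀ h00 hfin0).1] with x hx
    apply ENNReal.ofReal_le_ofReal
    apply Real.exp_le_exp.2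
    have : (0:ℝ) ≤ j * x := by positivity
    nlinarith
  have hpoly : ∀ p : Polynomial ℝ,
      Tendsto (fun n => ∫ x, p.eval (Real.exp (-x)) * Real.exp (-x) ∂ν n) atTop
      (nhds (∫ x, p.eval (Real.exp (-x)) * Real.exp (-x) ∂ν₀)) := by
    intro p
    have e : ∀ m : Measure ℝ, m (Iio 0) = 0 → ∫⁻ x, ENNReal.ofReal (Real.exp (-x)) ∂m ≠ ∞ →
        ∫ x, p.eval (Real.exp (-x)) * Real.exp (-x) ∂m =
        ∑ i ∈ Finset.range (p.natDegree + 1),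
          p.coeff i * ∫ x, (Real.exp (-x)) ^ i * Real.exp (-x) ∂m := by
      intro m h1 h2
      simp only [Polynomial.eval_eq_sum_range, Finset.sum_mul, mul_assoc]
      rw [integral_finsetSum]
      · simp only [integral_const_mul]
      · intro i _
        exact ((lap_int m h1 h2).2.2 (fun z => z ^ i) (by fun_prop)).const_mul _
    rw [e ν₀ h00 hfin0]
    simp only [fun n => e (ν n) (h0 n) (hfin n)]
    exact tendsto_finsetSum _ fun i _ => (hmon i).const_mul _
  have hM := hmon 0
  simp only [pow_zero, one_mul] at hM
  set M : ℕ → ℝ := fun n => ∫ x, Real.exp (-x) ∂ν n with hMdef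
  set M₀ : ℝ := ∫ x, Real.exp (-x) ∂ν₀ with hM0
  have hM0n : 0 ≤ M₀ := integral_nonneg fun x => (Real.exp_pos _).le
  have hdiff : ∀ m : Measure ℝ, m (Iio 0) = 0 → ∫⁻ x, ENNReal.ofReal (Real.exp (-x)) ∂m ≠ ∞ →
      ∀ (p : Polynomial ℝ) (ε : ℝ), (∀ z ∈ Icc (0:ℝ) 1, |p.eval z - f z| < ε) →
      |∫ x, p.eval (Real.exp (-x)) * Real.exp (-x) ∂m - ∫ x, f (Real.exp (-x)) * Real.exp (-x) ∂m|
        ≤ ε * ∫ x, Real.exp (-x) ∂m := by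
    intro m h1 h2 p ε hp
    obtain ⟨hp0, hi, hi2⟩ := lap_int m h1 h2
    rw [← integral_sub (hi2 (fun z => p.eval z) (by fun_prop)) (hi2 f hf), ← integral_const_mul,
      ← Real.norm_eq_abs]
    refine norm_integral_le_of_norm_le (hi.const_mul _) ?_
    filter_upwards [hp0] with x hx
    rw [← sub_mul, norm_mul, Real.norm_eq_abs, Real.norm_eq_abs, abs_of_pos (Real.exp_pos (-x))]
    exact mul_le_mul_of_nonneg_right
      (hp _ ⟨(Real.exp_pos _).le, Real.exp_le_one_iff.2 (by linarith)⟩).le (Real.exp_pos _).le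
  rw [Metric.tendsto_atTop]
  intro ε hε
  have hδ : 0 < ε / (4 * (M₀ + 1)) := by positivity
  obtain ⟨p, hp⟩ := exists_polynomial_near_of_continuousOn 0 1 f hf.continuousOn _ hδ
  have e1 : ∀ᶠ n in atTop, M n < M₀ + 1 := hM.eventually (gt_mem_nhds (by linarith))
  have e2 := (Metric.tendsto_nhds.1 (hpoly p)) (ε/4) (by positivity)
  obtain ⟨N, hN⟩ := eventually_atTop.1 (e1.and e2)
  refine ⟨N, fun n hn => ?_⟩
  obtain ⟨h1, h2⟩ := hN n hn
  have d1 := hdiff _ (h0 n) (hfin n) p _ hp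
  have d2 := hdiff _ h00 hfin0 p _ hp
  have d3 : ε / (4 * (M₀ + 1)) * M n ≤ ε / 4 := by
    calc _ ≤ ε / (4 * (M₀ + 1)) * (M₀ + 1) := by gcongr
      _ = _ := by field_simp
  have d4 : ε / (4 * (M₀ + 1)) * M₀ ≤ ε / 4 := by
    calc _ ≤ ε / (4 * (M₀ + 1)) * (M₀ + 1) := by gcongr; linarith
      _ = _ := by field_simp
  rw [Real.dist_eq] at h2 ⊢
  have d1' := abs_le.1 (d1.trans d3)
  have d2' := abs_le.1 (d2.trans d4)
  have h2' := abs_lt.1 h2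
  rw [abs_lt]
  constructor <;> linarith [d1'.1, d1'.2, d2'.1, d2'.2, h2'.1, h2'.2]

lemma lap_ramp (a a' : ℝ) (haa : a < a') : ∃ f : ℝ → ℝ, Continuous f ∧
    (∀ x, 0 ≤ f (Real.exp (-x)) * Real.exp (-x)) ∧
    (∀ x, f (Real.exp (-x)) * Real.exp (-x) ≤ 1) ∧
    (∀ x, x ≤ a → f (Real.exp (-x)) * Real.exp (-x) = 1) ∧
    (∀ x, a' ≤ x → f (Real.exp (-x)) * Real.exp (-x) = 0) := by
  have hd : Real.exp (-a') < Real.exp (-a) := Real.exp_lt_exp.2 (by linarith)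
  have hd' : 0 < Real.exp (-a) - Real.exp (-a') := by linarith
  have hz : ∀ z : ℝ, 0 < max z (Real.exp (-a')) :=
    fun z => lt_max_of_lt_right (Real.exp_pos _)
  refine ⟨fun z => max 0 (min 1 ((z - Real.exp (-a')) / (Real.exp (-a) - Real.exp (-a')))) /
    max z (Real.exp (-a')), ?_, ?_, ?_, ?_, ?_⟩
  · refine Continuous.div (by fun_prop) (by fun_prop) fun z => (hz z).ne'
  · intro x
    have := hz (Real.exp (-x))
    positivity
  · intro x
    have h1 := hz (Real.exp (-x))
    rw [div_mul_eq_mul_div, div_le_one h1]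
    have : max 0 (min 1 ((Real.exp (-x) - Real.exp (-a')) / (Real.exp (-a) - Real.exp (-a')))) ≤ 1 :=
      max_le zero_le_one (min_le_left _ _)
    calc _ ≤ 1 * Real.exp (-x) := by gcongr
      _ ≤ _ := by rw [one_mul]; exact le_max_left _ _
  · intro x hx
    have h1 : Real.exp (-a) ≤ Real.exp (-x) := Real.exp_le_exp.2 (by linarith)
    have h2 : 1 ≤ (Real.exp (-x) - Real.exp (-a')) / (Real.exp (-a) - Real.exp (-a')) := by
      rw [le_div_iff₀ hd']; linarith
    simp only [min_eq_left h2, max_eq_right zero_le_one, max_eq_left (hd.le.trans h1)]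
    field_simp
  · intro x hx
    have h1 : Real.exp (-x) ≤ Real.exp (-a') := Real.exp_le_exp.2 (by linarith)
    have h2 : (Real.exp (-x) - Real.exp (-a')) / (Real.exp (-a) - Real.exp (-a')) ≤ 0 :=
      div_nonpos_of_nonpos_of_nonneg (by linarith) hd'.le
    have h3 := (min_le_right 1 _).trans h2
    simp only [max_eq_left h3]
    simp

lemma lap_meas_fin (ν : Measure ℝ)
    (hfin : ∫⁻ x, ENNReal.ofReal (Real.exp (-x)) ∂ν ≠ ∞) (a : ℝ) : ν (Iio a) ≠ ∞ := by
  have h := meas_ge_le_lintegral_div (μ := ν) (f := fun x => ENNReal.ofReal (Real.exp (-x)))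
    (by fun_prop) (ε := ENNReal.ofReal (Real.exp (-a))) (by simp [Real.exp_pos]) (by simp)
  refine ne_top_of_le_ne_top ?_ ((measure_mono ?_).trans h)
  · exact ENNReal.div_ne_top hfin (by simp [Real.exp_pos])
  · intro x hx
    exact ENNReal.ofReal_le_ofReal (Real.exp_le_exp.2 (by simp at hx; linarith))

lemma lap_cont (ν : ℕ → Measure ℝ) (ν₀ : Measure ℝ)
    (h0 : ∀ n, ν n (Iio 0) = 0) (h00 : ν₀ (Iio 0) = 0)
    (hfin : ∀ n, ∫⁻ x, ENNReal.ofReal (Real.exp (-x)) ∂ν n ≠ ∞)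
    (hfin0 : ∫⁻ x, ENNReal.ofReal (Real.exp (-x)) ∂ν₀ ≠ ∞)
    (hconv : ∀ j : ℕ, Tendsto (fun n => ∫⁻ x, ENNReal.ofReal (Real.exp (-(((j:ℝ)+1)*x))) ∂ν n)
      atTop (nhds (∫⁻ x, ENNReal.ofReal (Real.exp (-(((j:ℝ)+1)*x))) ∂ν₀)))
    (a : ℝ) (hF : ContinuousAt (fun x => (ν₀ (Iio x)).toReal) a) :
    Tendsto (fun n => (ν n (Iio a)).toReal) atTop (nhds (ν₀ (Iio a)).toReal) := by
  have bd : ∀ m : Measure ℝ, m (Iio 0) = 0 → ∫⁻ x, ENNReal.ofReal (Real.exp (-x)) ∂m ≠ ∞ →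
      ∀ f : ℝ → ℝ, Continuous f → ∀ a a' : ℝ,
      (∀ x, 0 ≤ f (Real.exp (-x)) * Real.exp (-x)) →
      (∀ x, f (Real.exp (-x)) * Real.exp (-x) ≤ 1) →
      (∀ x, x ≤ a → f (Real.exp (-x)) * Real.exp (-x) = 1) →
      (∀ x, a' ≤ x → f (Real.exp (-x)) * Real.exp (-x) = 0) →
      (m (Iio a)).toReal ≤ ∫ x, f (Real.exp (-x)) * Real.exp (-x) ∂m ∧
      ∫ x, f (Real.exp (-x)) * Real.exp (-x) ∂m ≤ (m (Iio a')).toReal := by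
    intro m h1 h2 f hf a a' g1 g2 g3 g4
    have hi := (lap_int m h1 h2).2.2 f hf
    have ind : ∀ t, Integrable ((Iio t).indicator (1 : ℝ → ℝ)) m := fun t =>
      (integrable_indicator_iff measurableSet_Iio).2
        (integrableOn_const (lap_meas_fin m h2 t) (by simp))
    have indi : ∀ t, ∫ x, (Iio t).indicator (1 : ℝ → ℝ) x ∂m = (m (Iio t)).toReal := fun t => by
      rw [integral_indicator_one measurableSet_Iio]; rfl
    constructor
    · rw [← indi]
      refine integral_mono (ind a) hi fun x => ?_
      by_cases hx : x < a
      · simp [indicator, hx, g3 x hx.le]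
      · simp [indicator, hx, g1 x]
    · rw [← indi]
      refine integral_mono hi (ind a') fun x => ?_
      by_cases hx : x < a'
      · simp [indicator, hx, g2 x]
      · simp [indicator, hx, g4 x (not_lt.1 hx)]
  rw [tendsto_order]
  constructor
  · intro r hr
    have : ∀ᶠ x in nhds a, r < (ν₀ (Iio x)).toReal := hF.eventually (lt_mem_nhds hr)
    obtain ⟨x, hx, hxa⟩ := (Filter.Eventually.and (this.filter_mono nhdsWithin_le_nhds)
      (self_mem_nhdsWithin : Iio a ∈ nhdsWithin a (Iio a))).exists
    obtain ⟨f, hf, g1, g2, g3, g4⟩ := lap_ramp x a hxa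
    have ht := lap_test ν ν₀ h0 h00 hfin hfin0 hconv f hf
    have b0 := (bd ν₀ h00 hfin0 f hf x a g1 g2 g3 g4).1
    filter_upwards [ht.eventually (lt_mem_nhds (hx.trans_le b0))] with n hn
    exact hn.trans_le (bd (ν n) (h0 n) (hfin n) f hf x a g1 g2 g3 g4).2
  · intro r hr
    have : ∀ᶠ x in nhds a, (ν₀ (Iio x)).toReal < r := hF.eventually (gt_mem_nhds hr)
    obtain ⟨x, hx, hxa⟩ := (Filter.Eventually.and (this.filter_mono nhdsWithin_le_nhds)
      (self_mem_nhdsWithin : Ioi a ∈ nhdsWithin a (Ioi a))).exists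
    obtain ⟨f, hf, g1, g2, g3, g4⟩ := lap_ramp a x hxa
    have ht := lap_test ν ν₀ h0 h00 hfin hfin0 hconv f hf
    have b0 := (bd ν₀ h00 hfin0 f hf a x g1 g2 g3 g4).2
    filter_upwards [ht.eventually (gt_mem_nhds (b0.trans_lt hx))] with n hn
    exact (bd (ν n) (h0 n) (hfin n) f hf a x g1 g2 g3 g4).1.trans_lt hn

/-- Power density measure on the half line. -/
noncomputable def powM (s C : ℝ) : Measure ℝ :=
  (volume.restrict (Ioi 0)).withDensity (fun x => ENNReal.ofReal (C * x ^ (s - 1)))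

lemma powM_lap (s C r : ℝ) (hs : 0 < s) (hC : 0 ≤ C) (hr : 0 < r) :
    ∫⁻ x, ENNReal.ofReal (Real.exp (-(r * x))) ∂(powM s C) =
      ENNReal.ofReal (C * ((1 / r) ^ s * Real.Gamma s)) := by
  have hI := Real.integral_rpow_mul_exp_neg_mul_Ioi hs hr
  have hIntg : Integrable (fun t : ℝ => t ^ (s - 1) * Real.exp (-(r * t)))
      (volume.restrict (Ioi 0)) := by
    by_contra h
    rw [integral_undef h] at hI
    have := Real.Gamma_pos_of_pos hs
    have : 0 < (1 / r) ^ s * Real.Gamma s := by positivity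
    linarith
  rw [powM, lintegral_withDensity_eq_lintegral_mul _ (by fun_prop) (by fun_prop), ← hI,
    ← integral_const_mul, ofReal_integral_eq_lintegral_ofReal (hIntg.const_mul _)]
  · refine setLIntegral_congr_fun measurableSet_Ioi fun x hx => ?_
    have : 0 ≤ x ^ (s - 1) := Real.rpow_nonneg (le_of_lt hx) _
    simp only [Pi.mul_apply]
    rw [← ENNReal.ofReal_mul (by positivity), mul_assoc]
  · filter_upwards [ae_restrict_mem measurableSet_Ioi] with x hx
    have : 0 ≤ x ^ (s - 1) := Real.rpow_nonneg (le_of_lt hx) _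
    simp only [Pi.zero_apply]
    positivity

lemma powM_Iio0 (s C : ℝ) : powM s C (Iio 0) = 0 := by
  rw [powM, withDensity_apply _ measurableSet_Iio, Measure.restrict_restrict measurableSet_Iio]
  have : Iio (0:ℝ) ∩ Ioi 0 = ∅ := by
    ext x; simp only [mem_inter_iff, mem_Iio, mem_Ioi, mem_empty_iff_false, iff_false]
    intro h; linarith [h.1, h.2]
  simp [this]

lemma powM_Iio (s C x : ℝ) (hs : 0 < s) (hC : 0 ≤ C) (hx : 0 < x) :
    powM s C (Iio x) = ENNReal.ofReal (C * (x ^ s / s)) := by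
  rw [powM, withDensity_apply _ measurableSet_Iio, Measure.restrict_restrict measurableSet_Iio]
  have e : Iio x ∩ Ioi 0 = Ioo 0 x := by ext; simp [and_comm]
  have hi := intervalIntegral.intervalIntegrable_rpow' (a := 0) (b := x) (r := s - 1) (by linarith)
  have hI := integral_rpow (a := 0) (b := x) (r := s - 1) (Or.inl (by linarith))
  rw [sub_add_cancel, Real.zero_rpow hs.ne', sub_zero, intervalIntegral.integral_of_le hx.le] at hI
  rw [intervalIntegrable_iff_integrableOn_Ioc_of_le hx.le] at hi
  rw [e, restrict_Ioo_eq_restrict_Ioc, ← hI, ← integral_const_mul,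
    ofReal_integral_eq_lintegral_ofReal (hi.const_mul _)]
  filter_upwards [ae_restrict_mem measurableSet_Ioc] with x hx
  have : 0 ≤ x ^ (s - 1) := Real.rpow_nonneg hx.1.le _
  simp only [Pi.zero_apply]
  positivity

lemma powM_cont (s C x : ℝ) (hs : 0 < s) (hC : 0 ≤ C) (hx : 0 < x) :
    ContinuousAt (fun x => (powM s C (Iio x)).toReal) x := by
  have h : (fun x => C * (x ^ s / s)) =ᶠ[nhds x] (fun x => (powM s C (Iio x)).toReal) := by
    filter_upwards [lt_mem_nhds hx] with y hy
    rw [powM_Iio s C y hs hC hy, ENNReal.toReal_ofReal]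
    have : 0 ≤ y ^ s := Real.rpow_nonneg (le_of_lt hy) _
    positivity
  refine ContinuousAt.congr ?_ h
  exact ((Real.continuousAt_rpow_const x s (Or.inl hx.ne')).div_const s).const_mul C

lemma exp_lim (K : ℝ) :
    Tendsto (fun k : ℕ => (1 - Real.exp (-((1/2:ℝ)^k * K))) / (1/2:ℝ)^k) atTop (nhds K) := by
  have hd : HasDerivAt (fun h : ℝ => 1 - Real.exp (-(h * K))) K 0 := by
    have := (((hasDerivAt_id (0:ℝ)).mul_const K).neg.exp).const_sub 1
    simpa using this
  have h1 := hd.tendsto_slope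
  have h2 : Tendsto (fun k : ℕ => (1/2:ℝ)^k) atTop (nhdsWithin 0 {0}ᶜ) := by
    rw [tendsto_nhdsWithin_iff]
    exact ⟨tendsto_pow_atTop_nhds_zero_of_lt_one (by norm_num) (by norm_num),
      Eventually.of_forall fun k => by simp⟩
  refine (h1.comp h2).congr fun k => ?_
  simp [slope_def_field]

section
variable {Ω : Type*} [MeasurableSpace Ω] {μ : Measure Ω} [IsProbabilityMeasure μ]

lemma lap_lintegral (c α : ℝ) (V : ℝ → Ω → ℝ)
    (hVlaplace : ∀ t : ℝ, 0 ≤ t → ∀ lam : ℝ, 0 ≤ lam →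
      (∫ ω, Real.exp (-(lam * V t ω)) ∂μ) = Real.exp (-(t * c * lam ^ α)))
    (t r : ℝ) (ht : 0 ≤ t) (hr : 0 ≤ r) :
    Integrable (fun ω => Real.exp (-(r * V t ω))) μ ∧
    ∫⁻ ω, ENNReal.ofReal (Real.exp (-(r * V t ω))) ∂μ =
      ENNReal.ofReal (Real.exp (-(t * c * r ^ α))) := by
  have hi : Integrable (fun ω => Real.exp (-(r * V t ω))) μ := by
    by_contra h
    have := hVlaplace t ht r hr
    rw [integral_undef h] at this
    exact (Real.exp_pos _).ne this
  refine ⟨hi, ?_⟩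
  rw [← hVlaplace t ht r hr, ofReal_integral_eq_lintegral_ofReal hi]
  exact Eventually.of_forall fun x => (Real.exp_pos _).le

lemma renewal_lim (α c : ℝ) (hα : α ∈ Set.Ioo (0:ℝ) 1) (hc : 0 < c)
    (V : ℝ → Ω → ℝ) (hVmeas : ∀ t, Measurable (V t))
    (hpos : ∀ t, 0 ≤ t → ∀ ω, 0 ≤ V t ω)
    (hVlaplace : ∀ t : ℝ, 0 ≤ t → ∀ lam : ℝ, 0 ≤ lam →
      (∫ ω, Real.exp (-(lam * V t ω)) ∂μ) = Real.exp (-(t * c * lam ^ α)))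
    (x : ℝ) (hx : 0 < x) :
    (∀ k : ℕ, ∑' n : ℕ, μ {ω | V (n * (1/2:ℝ)^k) ω < x} ≠ ∞) ∧
    Tendsto (fun k : ℕ => (1/2:ℝ)^k * (∑' n : ℕ, μ {ω | V (n * (1/2:ℝ)^k) ω < x}).toReal) atTop
      (nhds (x ^ α / (α * c * Real.Gamma α))) := by
  set C : ℝ := 1 / (c * Real.Gamma α) with hCdef
  have hG := Real.Gamma_pos_of_pos hα.1
  have hα0 := hα.1
  have hC : 0 < C := by positivity
  set ν : ℕ → Measure ℝ := fun k =>
    ENNReal.ofReal ((1/2:ℝ)^k) • Measure.sum fun n : ℕ => μ.map (V (n * (1/2:ℝ)^k)) with hν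
  have hνm : ∀ k, ∀ s : Set ℝ, MeasurableSet s →
      ν k s = ENNReal.ofReal ((1/2:ℝ)^k) * ∑' n : ℕ, μ (V (n * (1/2:ℝ)^k) ⁻¹' s) := by
    intro k s hs
    simp only [hν, Measure.smul_apply, smul_eq_mul]
    rw [Measure.sum_apply _ hs]
    congr 1
    exact tsum_congr fun n => Measure.map_apply (hVmeas _) hs
  have hνl : ∀ k, ∀ r : ℝ, 0 < r → ∫⁻ y, ENNReal.ofReal (Real.exp (-(r * y))) ∂ν k =
      ENNReal.ofReal (((1 - Real.exp (-((1/2:ℝ)^k * (c * r ^ α)))) / (1/2:ℝ)^k)⁻¹) := by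
    intro k r hr
    have hq : Real.exp (-((1/2:ℝ)^k * (c * r ^ α))) < 1 := by
      rw [Real.exp_lt_one_iff]
      have : 0 < (1/2:ℝ)^k * (c * r ^ α) := by positivity
      linarith
    simp only [hν]
    rw [lintegral_smul_measure, lintegral_sum_measure]
    have : ∀ n : ℕ, ∫⁻ y, ENNReal.ofReal (Real.exp (-(r * y))) ∂(μ.map (V (n * (1/2:ℝ)^k))) =
        ENNReal.ofReal ((Real.exp (-((1/2:ℝ)^k * (c * r ^ α)))) ^ n) := by
      intro n
      rw [lintegral_map (by fun_prop) (hVmeas _),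
        (lap_lintegral c α V hVlaplace _ r (by positivity) hr.le).2, ← Real.exp_nat_mul]
      congr 2; ring
    simp only [this, smul_eq_mul]
    rw [← ENNReal.ofReal_tsum_of_nonneg (fun n => by positivity)
      (summable_geometric_of_lt_one (Real.exp_pos _).le hq),
      tsum_geometric_of_lt_one (Real.exp_pos _).le hq, ← ENNReal.ofReal_mul (by positivity)]
    congr 1
    rw [inv_div]
    exact (div_eq_mul_inv _ _).symm
  have hlim : ∀ j : ℕ,
      Tendsto (fun n => ∫⁻ x, ENNReal.ofReal (Real.exp (-(((j:ℝ)+1)*x))) ∂ν n)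
      atTop (nhds (∫⁻ x, ENNReal.ofReal (Real.exp (-(((j:ℝ)+1)*x))) ∂(powM α C))) := by
    intro j
    have hj : (0:ℝ) < (j:ℝ) + 1 := by positivity
    simp only [fun n => hνl n _ hj]
    rw [powM_lap α C _ hα0 hC.le hj]
    apply ENNReal.tendsto_ofReal
    have hK : 0 < c * ((j:ℝ)+1) ^ α := by positivity
    convert (exp_lim (c * ((j:ℝ)+1) ^ α)).inv₀ hK.ne' using 2
    rw [hCdef, Real.div_rpow (by norm_num) hj.le, Real.one_rpow]
    field_simp
  have hfin : ∀ n, ∫⁻ x, ENNReal.ofReal (Real.exp (-x)) ∂ν n ≠ ∞ := by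
    intro n
    have := hνl n 1 one_pos
    simp only [one_mul] at this
    rw [this]; exact ENNReal.ofReal_ne_top
  have hfin0 : ∫⁻ x, ENNReal.ofReal (Real.exp (-x)) ∂(powM α C) ≠ ∞ := by
    have := powM_lap α C 1 hα0 hC.le one_pos
    simp only [one_mul] at this
    rw [this]; exact ENNReal.ofReal_ne_top
  have h0 : ∀ n, ν n (Iio 0) = 0 := by
    intro n
    rw [hνm _ _ measurableSet_Iio]
    have : ∀ i : ℕ, V (i * (1/2:ℝ)^n) ⁻¹' (Iio 0) = ∅ := by
      intro i; ext ω
      simpa using hpos (i * (1/2:ℝ)^n) (by positivity) ω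
    simp only [this, measure_empty, tsum_zero, mul_zero]
  have main := lap_cont ν (powM α C) h0 (powM_Iio0 _ _) hfin hfin0 hlim x
    (powM_cont α C x hα0 hC.le hx)
  rw [powM_Iio α C x hα0 hC.le hx, ENNReal.toReal_ofReal (by positivity)] at main
  constructor
  · intro k hk
    have := lap_meas_fin (ν k) (hfin k) x
    rw [hνm _ _ measurableSet_Iio] at this
    apply this
    have e : (∑' n : ℕ, μ (V (n * (1/2:ℝ)^k) ⁻¹' Iio x)) = ∞ := hk
    rw [e]
    exact ENNReal.mul_top (by simp)
  · convert main using 1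
    · ext k
      rw [hνm _ _ measurableSet_Iio, ENNReal.toReal_mul, ENNReal.toReal_ofReal (by positivity)]
      rfl
    · congr 1
      rw [hCdef]; field_simp

lemma tail_lim (α c : ℝ) (hα : α ∈ Set.Ioo (0:ℝ) 1) (hc : 0 < c)
    (V : ℝ → Ω → ℝ) (hVmeas : ∀ t, Measurable (V t))
    (hpos : ∀ t, 0 ≤ t → ∀ ω, 0 ≤ V t ω)
    (hVlaplace : ∀ t : ℝ, 0 ≤ t → ∀ lam : ℝ, 0 ≤ lam →
      (∫ ω, Real.exp (-(lam * V t ω)) ∂μ) = Real.exp (-(t * c * lam ^ α)))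
    (y : ℝ) (hy : 0 < y) :
    Tendsto (fun k : ℕ => (μ {ω | y < V ((1/2:ℝ)^k) ω}).toReal / (1/2:ℝ)^k) atTop
      (nhds (c / Real.Gamma (1 - α) * y ^ (-α))) := by
  have hs : 0 < 1 - α := by linarith [hα.2]
  have hG := Real.Gamma_pos_of_pos hs
  set C : ℝ := c / Real.Gamma (1 - α) with hCdef
  have hC : 0 < C := by positivity
  set p : ℕ → ℝ → ℝ≥0∞ := fun k y => μ {ω | y < V ((1/2:ℝ)^k) ω} with hp
  have hpanti : ∀ k, Antitone (p k) := fun k y z hyz =>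
    measure_mono fun ω (h : z < _) => lt_of_le_of_lt hyz h
  have hpm : ∀ k, Measurable (p k) := fun k => (hpanti k).measurable
  set ν : ℕ → Measure ℝ := fun k =>
    (volume.restrict (Ioi 0)).withDensity (fun y => p k y * ENNReal.ofReal (1 / (1/2:ℝ)^k)) with hν
  have hνl : ∀ k, ∀ r : ℝ, 0 < r → ∫⁻ y, ENNReal.ofReal (Real.exp (-(r * y))) ∂ν k =
      ENNReal.ofReal ((1 - Real.exp (-((1/2:ℝ)^k * (c * r ^ α)))) / (1/2:ℝ)^k / r) := by
    intro k r hr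
    set h : ℝ := (1/2:ℝ)^k with hh
    have hh0 : 0 < h := by positivity
    have hl := lintegral_comp_eq_lintegral_meas_lt_mul (f := V h)
      (g := fun t => 1 / h * Real.exp (-(r * t))) μ
      (Eventually.of_forall (hpos h hh0.le)) (hVmeas h).aemeasurable
      (fun t _ => (by fun_prop : Continuous _).intervalIntegrable _ _)
      (Eventually.of_forall fun t => by positivity)
    have hin : ∀ v : ℝ, ∫ t in (0:ℝ)..v, 1 / h * Real.exp (-(r * t)) =
        (1 - Real.exp (-(r * v))) / h / r := by
      intro v
      rw [intervalIntegral.integral_const_mul]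
      have : ∀ t : ℝ, HasDerivAt (fun t => - (Real.exp (-(r * t)) / r)) (Real.exp (-(r * t))) t := by
        intro t
        have := ((((hasDerivAt_id t).const_mul r).neg.exp).div_const r).neg
        refine this.congr_deriv ?_
        simp only [id, mul_one]
        field_simp
        rfl
      rw [intervalIntegral.integral_eq_sub_of_hasDerivAt (fun t _ => this t)
        ((by fun_prop : Continuous _).intervalIntegrable _ _)]
      simp; field_simp; ring
    simp only [hin] at hl
    obtain ⟨hi1, _⟩ := lap_lintegral c α V hVlaplace h r hh0.le hr.le
    have hi3 : Integrable (fun ω => (1 - Real.exp (-(r * V h ω))) / h / r) μ :=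
      (((integrable_const (1:ℝ)).sub hi1).div_const h).div_const r
    rw [← ofReal_integral_eq_lintegral_ofReal hi3] at hl
    · rw [integral_div, integral_div, integral_sub (integrable_const _) hi1,
        hVlaplace h hh0.le r hr.le] at hl
      simp only [integral_const, probReal_univ, smul_eq_mul, mul_one] at hl
      rw [← mul_assoc h c, hl, hν, lintegral_withDensity_eq_lintegral_mul _ (by fun_prop) (by fun_prop)]
      refine lintegral_congr fun y => ?_
      simp only [Pi.mul_apply]
      rw [ENNReal.ofReal_mul (by positivity), mul_assoc]
    · refine Eventually.of_forall fun ω => ?_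
      have : Real.exp (-(r * V h ω)) ≤ 1 := by
        rw [Real.exp_le_one_iff]
        have := mul_nonneg hr.le (hpos h hh0.le ω)
        linarith
      have : 0 ≤ 1 - Real.exp (-(r * V h ω)) := by linarith
      simp only [Pi.zero_apply]
      positivity
  have hlim : ∀ j : ℕ,
      Tendsto (fun n => ∫⁻ x, ENNReal.ofReal (Real.exp (-(((j:ℝ)+1)*x))) ∂ν n)
      atTop (nhds (∫⁻ x, ENNReal.ofReal (Real.exp (-(((j:ℝ)+1)*x))) ∂(powM (1-α) C))) := by
    intro j
    have hj : (0:ℝ) < (j:ℝ) + 1 := by positivity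
    simp only [fun n => hνl n _ hj]
    rw [powM_lap (1-α) C _ hs hC.le hj]
    apply ENNReal.tendsto_ofReal
    convert (exp_lim (c * ((j:ℝ)+1) ^ α)).div_const ((j:ℝ)+1) using 2
    rw [hCdef, Real.div_rpow (by norm_num) hj.le, Real.one_rpow, Real.rpow_sub hj, Real.rpow_one]
    field_simp
  have hfin : ∀ n, ∫⁻ x, ENNReal.ofReal (Real.exp (-x)) ∂ν n ≠ ∞ := by
    intro n
    have := hνl n 1 one_pos
    simp only [one_mul] at this
    rw [this]; exact ENNReal.ofReal_ne_top
  have hfin0 : ∫⁻ x, ENNReal.ofReal (Real.exp (-x)) ∂(powM (1-α) C) ≠ ∞ := by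
    have := powM_lap (1-α) C 1 hs hC.le one_pos
    simp only [one_mul] at this
    rw [this]; exact ENNReal.ofReal_ne_top
  have h0 : ∀ n, ν n (Iio 0) = 0 := by
    intro n
    rw [hν, withDensity_apply _ measurableSet_Iio, Measure.restrict_restrict measurableSet_Iio]
    have : Iio (0:ℝ) ∩ Ioi 0 = ∅ := by
      ext x; simp only [mem_inter_iff, mem_Iio, mem_Ioi, mem_empty_iff_false, iff_false]
      intro h; linarith [h.1, h.2]
    simp [this]
  have main : ∀ x, 0 < x → Tendsto (fun n => (ν n (Iio x)).toReal) atTop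
      (nhds (C * (x ^ (1-α) / (1-α)))) := by
    intro x hx
    have := lap_cont ν (powM (1-α) C) h0 (powM_Iio0 _ _) hfin hfin0 hlim x
      (powM_cont (1-α) C x hs hC.le hx)
    rwa [powM_Iio (1-α) C x hs hC.le hx, ENNReal.toReal_ofReal (by positivity)] at this
  -- increments
  have hinc : ∀ k (u v : ℝ), 0 < u → u < v →
      (p k v).toReal / (1/2:ℝ)^k * (v - u) ≤ (ν k (Iio v)).toReal - (ν k (Iio u)).toReal ∧
      (ν k (Iio v)).toReal - (ν k (Iio u)).toReal ≤ (p k u).toReal / (1/2:ℝ)^k * (v - u) := by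
    intro k u v hu huv
    have e1 : (ν k (Iio v)).toReal - (ν k (Iio u)).toReal = (ν k (Ico u v)).toReal := by
      have : Iio v = Iio u ∪ Ico u v := by
        ext x; simp only [mem_Iio, mem_union, mem_Ico]; grind
      rw [this, measure_union _ measurableSet_Ico, ENNReal.toReal_add]
      · ring
      · exact lap_meas_fin _ (hfin k) u
      · exact ne_top_of_le_ne_top (lap_meas_fin _ (hfin k) v)
          (measure_mono fun x hx => hx.2)
      · rw [Set.disjoint_left]; intro x hx hx2; exact absurd hx2.1 (not_le.2 hx)
    have e2 : ν k (Ico u v) = ∫⁻ z in Ico u v, p k z * ENNReal.ofReal (1 / (1/2:ℝ)^k) := by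
      rw [hν, withDensity_apply _ measurableSet_Ico, Measure.restrict_restrict measurableSet_Ico]
      congr 2
      ext x; simp only [mem_inter_iff, mem_Ico, mem_Ioi]; grind
    have e3 : ∀ z, (p k z).toReal / (1/2:ℝ)^k * (v - u) =
        (∫⁻ _ in Ico u v, p k z * ENNReal.ofReal (1 / (1/2:ℝ)^k)).toReal := by
      intro z
      rw [setLIntegral_const, Real.volume_Ico, ENNReal.toReal_mul, ENNReal.toReal_mul,
        ENNReal.toReal_ofReal (by positivity), ENNReal.toReal_ofReal (by linarith)]
      ring
    have hfin' : ∀ z, (∫⁻ _ in Ico u v, p k z * ENNReal.ofReal (1 / (1/2:ℝ)^k)) ≠ ∞ := by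
      intro z
      rw [setLIntegral_const, Real.volume_Ico]
      exact ENNReal.mul_ne_top (ENNReal.mul_ne_top (measure_ne_top _ _) ENNReal.ofReal_ne_top)
        ENNReal.ofReal_ne_top
    have g1 : (∫⁻ _ in Ico u v, p k v * ENNReal.ofReal (1 / (1/2:ℝ)^k)) ≤ ν k (Ico u v) := by
      rw [e2]
      refine setLIntegral_mono (by fun_prop) fun z hz => ?_
      gcongr
      exact hpanti k hz.2.le
    have g2 : ν k (Ico u v) ≤ (∫⁻ _ in Ico u v, p k u * ENNReal.ofReal (1 / (1/2:ℝ)^k)) := by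
      rw [e2]
      refine setLIntegral_mono (by fun_prop) fun z hz => ?_
      gcongr
      exact hpanti k hz.1
    rw [e1, e3, e3]
    exact ⟨ENNReal.toReal_mono (ne_top_of_le_ne_top (hfin' u) g2) g1,
      ENNReal.toReal_mono (hfin' u) g2⟩
  -- derivative squeeze
  have hder : HasDerivAt (fun x => C * (x ^ (1-α) / (1-α))) (C * y ^ (-α)) y := by
    have := ((Real.hasDerivAt_rpow_const (p := 1-α) (Or.inl hy.ne')).div_const (1-α)).const_mul C
    refine this.congr_deriv ?_
    rw [show 1 - α - 1 = -α by ring]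
    field_simp
  have hsl := hasDerivAt_iff_tendsto_slope.1 hder
  rw [tendsto_order]
  constructor
  · intro r hr
    have h1 : ∀ᶠ v in nhdsWithin y (Ioi y), r < slope (fun x => C * (x ^ (1-α) / (1-α))) y v :=
      (hsl.mono_left (nhdsWithin_mono y (fun z (hz : y < z) => hz.ne'))).eventually (lt_mem_nhds hr)
    obtain ⟨v, hv, hyv⟩ := (h1.and (self_mem_nhdsWithin : Ioi y ∈ nhdsWithin y (Ioi y))).exists
    have hyv' : 0 < v - y := sub_pos.2 hyv
    rw [slope_def_field, lt_div_iff₀ hyv'] at hv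
    have ht := (main v (hy.trans hyv)).sub (main y hy)
    filter_upwards [ht.eventually (lt_mem_nhds hv)] with k hk
    exact lt_of_mul_lt_mul_right (hk.trans_le (hinc k y v hy hyv).2) hyv'.le
  · intro r hr
    have h1 : ∀ᶠ v in nhdsWithin y (Iio y), slope (fun x => C * (x ^ (1-α) / (1-α))) y v < r :=
      (hsl.mono_left (nhdsWithin_mono y (fun z (hz : z < y) => hz.ne))).eventually (gt_mem_nhds hr)
    have h2 : ∀ᶠ v in nhdsWithin y (Iio y), 0 < v := (lt_mem_nhds hy).filter_mono nhdsWithin_le_nhds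
    obtain ⟨v, ⟨hv, hv0⟩, hyv⟩ :=
      ((h1.and h2).and (self_mem_nhdsWithin : Iio y ∈ nhdsWithin y (Iio y))).exists
    have hyv' : 0 < y - v := sub_pos.2 hyv
    rw [slope_comm, slope_def_field, div_lt_iff₀ hyv'] at hv
    have ht := (main y hy).sub (main v hv0)
    filter_upwards [ht.eventually (gt_mem_nhds hv)] with k hk
    exact lt_of_mul_lt_mul_right ((hinc k v y hv0 hyv).1.trans_lt hk) hyv'.le

end
section
variable {Ω : Type*} [MeasurableSpace Ω] {μ : Measure Ω} [IsProbabilityMeasure μ]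

/-- The discretised event of jumping from below `x` to above `b` in one step of size `2⁻ᵏ`. -/
def jumpEv (V : ℝ → Ω → ℝ) (b : ℝ) (k : ℕ) (x : ℝ) : Set Ω :=
  ⋃ n : ℕ, {ω | V (n * (1/2:ℝ)^k) ω < x ∧ b < V (n * (1/2:ℝ)^k + (1/2:ℝ)^k) ω}

lemma jumpEv_meas (V : ℝ → Ω → ℝ) (hVmeas : ∀ t, Measurable (V t)) (b : ℝ) (k : ℕ) (x : ℝ) :
    MeasurableSet (jumpEv V b k x) :=
  MeasurableSet.iUnion fun _ => (measurableSet_lt (hVmeas _) measurable_const).inter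
    (measurableSet_lt measurable_const (hVmeas _))

lemma jumpEv_measure (V : ℝ → Ω → ℝ) (hVmeas : ∀ t, Measurable (V t))
    (hVmono : ∀ ω, MonotoneOn (fun t => V t ω) (Set.Ici 0)) (b : ℝ) (k : ℕ) (x : ℝ) (hx : x ≤ b) :
    μ (jumpEv V b k x) =
      ∑' n : ℕ, μ {ω | V (n * (1/2:ℝ)^k) ω < x ∧ b < V (n * (1/2:ℝ)^k + (1/2:ℝ)^k) ω} := by
  rw [jumpEv, measure_iUnion]
  · have key : ∀ i j : ℕ, i < j → Disjoint
        {ω | V (i * (1/2:ℝ)^k) ω < x ∧ b < V (i * (1/2:ℝ)^k + (1/2:ℝ)^k) ω}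
        {ω | V (j * (1/2:ℝ)^k) ω < x ∧ b < V (j * (1/2:ℝ)^k + (1/2:ℝ)^k) ω} := by
      intro i j hij
      rw [Set.disjoint_left]
      rintro ω ⟨_, h1⟩ ⟨h2, _⟩
      have hle : (i:ℝ) * (1/2:ℝ)^k + (1/2:ℝ)^k ≤ j * (1/2:ℝ)^k := by
        have : (i:ℝ) + 1 ≤ j := by exact_mod_cast hij
        have h3 : 0 < (1/2:ℝ)^k := by positivity
        nlinarith
      have := hVmono ω (mem_Ici.2 (by positivity)) (mem_Ici.2 (by positivity)) hle
      simp only at this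
      linarith
    intro i j hij
    rcases lt_or_gt_of_ne hij with h | h
    · exact key i j h
    · exact (key j i h).symm
  · exact fun n => (measurableSet_lt (hVmeas _) measurable_const).inter
      (measurableSet_lt measurable_const (hVmeas _))

lemma jumpEv_inc (V : ℝ → Ω → ℝ) (hVmeas : ∀ t, Measurable (V t))
    (hVmono : ∀ ω, MonotoneOn (fun t => V t ω) (Set.Ici 0))
    (hVindep : ∀ s t : ℝ, 0 ≤ s → 0 ≤ t →
      Indep (⨆ u ∈ Set.Icc (0:ℝ) t, MeasurableSpace.comap (V u) inferInstance)
        (MeasurableSpace.comap (fun ω => V (t + s) ω - V t ω) inferInstance) μ)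
    (hVstat : ∀ s t : ℝ, 0 ≤ s → 0 ≤ t →
      Measure.map (fun ω => V (t + s) ω - V t ω) μ = Measure.map (V s) μ)
    (hWfin : ∀ x : ℝ, 0 < x → ∀ k : ℕ, ∑' n : ℕ, μ {ω | V (n * (1/2:ℝ)^k) ω < x} ≠ ∞)
    (b : ℝ) (k : ℕ) (x y : ℝ) (hy0 : 0 < y) (hxy : x ≤ y) (hy : y ≤ b) :
    ((∑' n : ℕ, μ {ω | V (n * (1/2:ℝ)^k) ω < y}).toReal -
      (∑' n : ℕ, μ {ω | V (n * (1/2:ℝ)^k) ω < x}).toReal) *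
        (μ {ω | b - x < V ((1/2:ℝ)^k) ω}).toReal
      ≤ (μ (jumpEv V b k y)).toReal - (μ (jumpEv V b k x)).toReal ∧
    (μ (jumpEv V b k y)).toReal - (μ (jumpEv V b k x)).toReal ≤
    ((∑' n : ℕ, μ {ω | V (n * (1/2:ℝ)^k) ω < y}).toReal -
      (∑' n : ℕ, μ {ω | V (n * (1/2:ℝ)^k) ω < x}).toReal) *
        (μ {ω | b - y < V ((1/2:ℝ)^k) ω}).toReal := by
  set h : ℝ := (1/2:ℝ)^k with hh
  have hh0 : 0 < h := by positivity
  set D : ℕ → Set Ω := fun n => V (n * h) ⁻¹' (Ico x y) with hD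
  have hDm : ∀ n, MeasurableSet (D n) := fun n => hVmeas _ measurableSet_Ico
  have hind : ∀ n : ℕ, ∀ z : ℝ,
      μ (D n ∩ {ω | z < V (n * h + h) ω - V (n * h) ω}) = μ (D n) * μ {ω | z < V h ω} := by
    intro n z
    have ht : 0 ≤ (n:ℝ) * h := by positivity
    have h1 := (Indep_iff _ _ μ).1 (hVindep h (n * h) hh0.le ht) (D n)
      {ω | z < V (n * h + h) ω - V (n * h) ω} ?_ ?_
    · rw [h1]
      congr 1
      have h2 : Measure.map (fun ω => V (n * h + h) ω - V (n * h) ω) μ (Ioi z) =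
          Measure.map (V h) μ (Ioi z) := by rw [hVstat h (n * h) hh0.le ht]
      have hm : Measurable (fun ω => V (n * h + h) ω - V (n * h) ω) := (hVmeas _).sub (hVmeas _)
      rwa [Measure.map_apply hm measurableSet_Ioi,
        Measure.map_apply (hVmeas _) measurableSet_Ioi] at h2
    · have hle : MeasurableSpace.comap (V (n * h)) inferInstance ≤
          ⨆ u ∈ Set.Icc (0:ℝ) (n * h), MeasurableSpace.comap (V u) inferInstance :=
        le_iSup₂ (f := fun u (_ : u ∈ Set.Icc (0:ℝ) (n * h)) =>
          MeasurableSpace.comap (V u) inferInstance) (n * h : ℝ) ⟨ht, le_rfl⟩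
      exact hle _ ⟨Ico x y, measurableSet_Ico, rfl⟩
    · exact ⟨Ioi z, measurableSet_Ioi, rfl⟩
  have hsplit : ∀ (S : ℕ → Set Ω), (∀ n, MeasurableSet (S n)) →
      ∑' n : ℕ, μ ({ω | V (n * h) ω < y} ∩ S n) =
      ∑' n : ℕ, μ ({ω | V (n * h) ω < x} ∩ S n) + ∑' n : ℕ, μ (D n ∩ S n) := by
    intro S hS
    rw [← ENNReal.tsum_add]
    refine tsum_congr fun n => ?_
    rw [← measure_union _ ((hDm n).inter (hS n))]
    · congr 1
      ext ω
      simp only [hD, mem_inter_iff, mem_ofPred_eq, mem_union, mem_preimage, mem_Ico]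
      grind
    · rw [Set.disjoint_left]
      rintro ω ⟨h1, _⟩ ⟨h2, _⟩
      exact absurd h2.1 (not_le.2 h1)
  have hW := hsplit (fun _ => univ) (fun _ => MeasurableSet.univ)
  simp only [inter_univ] at hW
  have hG := hsplit (fun n => {ω | b < V (n * h + h) ω})
    (fun n => measurableSet_lt measurable_const (hVmeas _))
  have hGx := jumpEv_measure (μ := μ) V hVmeas hVmono b k x (hxy.trans hy)
  have hGy := jumpEv_measure (μ := μ) V hVmeas hVmono b k y hy
  have hG' : μ (jumpEv V b k y) = μ (jumpEv V b k x) +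
      ∑' n : ℕ, μ (D n ∩ {ω | b < V (n * h + h) ω}) := by
    rw [hGx, hGy]; exact hG
  have hyfin := hWfin y hy0 k
  rw [← hh, hW] at hyfin
  obtain ⟨hxf, hDf⟩ := ENNReal.add_ne_top.1 hyfin
  have hBf : ∑' n : ℕ, μ (D n ∩ {ω | b < V (n * h + h) ω}) ≠ ∞ := by
    have := measure_ne_top μ (jumpEv V b k y)
    rw [hG'] at this
    exact (ENNReal.add_ne_top.1 this).2
  rw [hG', hW, ENNReal.toReal_add (measure_ne_top _ _) hBf, ENNReal.toReal_add hxf hDf,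
    add_sub_cancel_left, add_sub_cancel_left, ← ENNReal.toReal_mul, ← ENNReal.toReal_mul]
  constructor
  · refine ENNReal.toReal_mono hBf ?_
    rw [← ENNReal.tsum_mul_right]
    refine ENNReal.tsum_le_tsum fun n => ?_
    rw [← hind]
    refine measure_mono ?_
    rintro ω ⟨h1, h2⟩
    refine ⟨h1, ?_⟩
    have := h1.1
    simp only [mem_ofPred_eq] at h2 ⊢
    linarith
  · refine ENNReal.toReal_mono (ENNReal.mul_ne_top hDf (measure_ne_top _ _)) ?_
    rw [← ENNReal.tsum_mul_right]
    refine ENNReal.tsum_le_tsum fun n => ?_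
    rw [← hind]
    refine measure_mono ?_
    rintro ω ⟨h1, h2⟩
    refine ⟨h1, ?_⟩
    have := h1.2
    simp only [mem_ofPred_eq] at h2 ⊢
    linarith

lemma jumpEv_anti (V : ℝ → Ω → ℝ)
    (hVmono : ∀ ω, MonotoneOn (fun t => V t ω) (Set.Ici 0)) (b : ℝ) (x : ℝ) :
    Antitone (fun k => jumpEv V b k x) := by
  refine antitone_nat_of_succ_le fun k => ?_
  intro ω hω
  obtain ⟨n, h1, h2⟩ := mem_iUnion.1 hω
  refine mem_iUnion.2 ⟨n / 2, ?_, ?_⟩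
  · refine lt_of_le_of_lt (hVmono ω (mem_Ici.2 (by positivity)) (mem_Ici.2 (by positivity)) ?_) h1
    rw [pow_succ]
    have h3 : 0 < (1/2:ℝ)^k := by positivity
    have : ((n / 2 : ℕ) : ℝ) * 2 ≤ n := by exact_mod_cast Nat.div_mul_le_self n 2
    nlinarith
  · refine lt_of_lt_of_le h2 (hVmono ω (mem_Ici.2 (by positivity)) (mem_Ici.2 (by positivity)) ?_)
    rw [pow_succ]
    have h3 : 0 < (1/2:ℝ)^k := by positivity
    have : (n : ℝ) + 1 ≤ ((n / 2 : ℕ) : ℝ) * 2 + 2 := by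
      have : n + 1 ≤ n / 2 * 2 + 2 := by omega
      exact_mod_cast this
    nlinarith

lemma jump_value (α c : ℝ) (hα : α ∈ Set.Ioo (0:ℝ) 1) (hc : 0 < c)
    (a b : ℝ) (ha : 0 < a) (hab : a < b)
    (V : ℝ → Ω → ℝ)
    (hVmeas : ∀ t, Measurable (V t))
    (hpos : ∀ t, 0 ≤ t → ∀ ω, 0 ≤ V t ω)
    (hVmono : ∀ ω, MonotoneOn (fun t => V t ω) (Set.Ici 0))
    (hVindep : ∀ s t : ℝ, 0 ≤ s → 0 ≤ t →
      Indep (⨆ u ∈ Set.Icc (0:ℝ) t, MeasurableSpace.comap (V u) inferInstance)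
        (MeasurableSpace.comap (fun ω => V (t + s) ω - V t ω) inferInstance) μ)
    (hVstat : ∀ s t : ℝ, 0 ≤ s → 0 ≤ t →
      Measure.map (fun ω => V (t + s) ω - V t ω) μ = Measure.map (V s) μ)
    (hVlaplace : ∀ t : ℝ, 0 ≤ t → ∀ lam : ℝ, 0 ≤ lam →
      (∫ ω, Real.exp (-(lam * V t ω)) ∂μ) = Real.exp (-(t * c * lam ^ α))) :
    (μ (⋂ k, jumpEv V b k a)).toReal = Asl α (a / b) := by
  have hα0 := hα.1
  have hs : 0 < 1 - α := by linarith [hα.2]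
  have hG1 := Real.Gamma_pos_of_pos hα0
  have hG2 := Real.Gamma_pos_of_pos hs
  have hb : 0 < b := ha.trans hab
  set g : ℝ → ℝ := fun x => (μ (⋂ k, jumpEv V b k x)).toReal with hg
  set U : ℝ → ℝ := fun x => x ^ α / (α * c * Real.Gamma α) with hU
  set P : ℝ → ℝ := fun y => c / Real.Gamma (1 - α) * y ^ (-α) with hP
  have hgl : ∀ x, Tendsto (fun k => (μ (jumpEv V b k x)).toReal) atTop (nhds (g x)) := by
    intro x
    refine (ENNReal.tendsto_toReal (measure_ne_top _ _)).comp ?_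
    exact tendsto_measure_iInter_atTop
      (fun k => (jumpEv_meas V hVmeas b k x).nullMeasurableSet) (jumpEv_anti V hVmono b x)
      ⟨0, measure_ne_top _ _⟩
  have hneg : ∀ (n k : ℕ), {ω | V (n * (1/2:ℝ)^k) ω < 0} = ∅ := by
    intro n k; ext ω
    simp only [mem_ofPred_eq, mem_empty_iff_false, iff_false, not_lt]
    exact hpos _ (by positivity) ω
  have hg0 : g 0 = 0 := by
    refine tendsto_nhds_unique (hgl 0) ?_
    have : ∀ k, jumpEv V b k 0 = ∅ := by
      intro k; ext ω
      simp only [jumpEv, mem_iUnion, mem_ofPred_eq, mem_empty_iff_false, iff_false, not_exists,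
        not_and]
      intro n hn
      exact absurd hn (not_lt.2 (hpos _ (by positivity) ω))
    simp [this]
  have hUl : ∀ x, 0 ≤ x → Tendsto (fun k : ℕ => (1/2:ℝ)^k *
      (∑' n : ℕ, μ {ω | V (n * (1/2:ℝ)^k) ω < x}).toReal) atTop (nhds (U x)) := by
    intro x hx
    rcases hx.eq_or_lt with rfl | hx
    · simp only [hneg, measure_empty, tsum_zero, ENNReal.toReal_zero, mul_zero]
      simp [hU, Real.zero_rpow hα0.ne']
    · exact (renewal_lim α c hα hc V hVmeas hpos hVlaplace x hx).2
  have hinc : ∀ x y, 0 ≤ x → x < y → y < b →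
      (U y - U x) * P (b - x) ≤ g y - g x ∧ g y - g x ≤ (U y - U x) * P (b - y) := by
    intro x y hx hxy hy
    have hy0 : 0 < y := hx.trans_lt hxy
    have hk := fun k => jumpEv_inc (μ := μ) V hVmeas hVmono hVindep hVstat
      (fun x hx => (renewal_lim α c hα hc V hVmeas hpos hVlaplace x hx).1) b k x y hy0 hxy.le hy.le
    have hcan : ∀ A B h p : ℝ, 0 < h → (h * A - h * B) * (p / h) = (A - B) * p := by
      intro A B h p hh
      field_simp
    have t1 := (hgl y).sub (hgl x)
    have t2 := (hUl y hy0.le).sub (hUl x hx)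
    have t3 := fun z (hz : 0 < z) => t2.mul (tail_lim α c hα hc V hVmeas hpos hVlaplace z hz)
    constructor
    · refine le_of_tendsto_of_tendsto (t3 (b - x) (by linarith)) t1 (Eventually.of_forall fun k => ?_)
      refine le_trans (le_of_eq ?_) (hk k).1
      exact hcan _ _ _ _ (by positivity)
    · refine le_of_tendsto_of_tendsto t1 (t3 (b - y) (by linarith)) (Eventually.of_forall fun k => ?_)
      refine le_trans (hk k).2 (le_of_eq ?_)
      exact (hcan _ _ _ _ (by positivity)).symm
  have hUc : Continuous U := by
    simp only [hU]
    exact (Real.continuous_rpow_const hα0.le).div_const _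
  have hPc : ∀ y, 0 < y → ContinuousAt P y := fun y hy =>
    (Real.continuousAt_rpow_const y (-α) (Or.inl hy.ne')).const_mul _
  have hUm : ∀ x y, 0 ≤ x → x ≤ y → U x ≤ U y := by
    intro x y hx hxy
    simp only [hU]
    gcongr
  have hPa : ∀ x y, 0 < x → x ≤ y → P y ≤ P x := by
    intro x y hx hxy
    simp only [hP]
    have := Real.rpow_le_rpow_of_nonpos hx hxy (by linarith : -α ≤ 0)
    gcongr
  have hP0 : ∀ y, 0 < y → 0 ≤ P y := fun y hy => by simp only [hP]; positivity
  have hdist : ∀ x ∈ Icc 0 a, ∀ y ∈ Icc 0 a, dist (g y) (g x) ≤ P (b - a) * dist (U y) (U x) := by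
    have key : ∀ x ∈ Icc 0 a, ∀ y ∈ Icc 0 a, x < y →
        dist (g y) (g x) ≤ P (b - a) * dist (U y) (U x) := by
      intro x hx y hy hxy
      obtain ⟨i1, i2⟩ := hinc x y hx.1 hxy (hy.2.trans_lt hab)
      have u := hUm x y hx.1 hxy.le
      have p1 := hP0 (b - x) (by linarith [hx.2])
      have p2 := hPa (b - a) (b - y) (by linarith) (by linarith [hy.2])
      rw [Real.dist_eq, Real.dist_eq, abs_of_nonneg (sub_nonneg.2 u), abs_of_nonneg]
      · nlinarith
      · nlinarith [mul_nonneg (sub_nonneg.2 u) p1]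
    intro x hx y hy
    rcases lt_trichotomy x y with h | h | h
    · exact key x hx y hy h
    · subst h; simp
    · rw [dist_comm (g y), dist_comm (U y)]; exact key y hy x hx h
  have hgc : ContinuousOn g (Icc 0 a) := by
    intro x hx
    rw [ContinuousWithinAt, tendsto_iff_dist_tendsto_zero]
    refine squeeze_zero' (Eventually.of_forall fun _ => dist_nonneg) ?_
      (g := fun y => P (b - a) * dist (U y) (U x)) ?_
    · filter_upwards [self_mem_nhdsWithin] with y hy using hdist x hx y hy
    · have : Tendsto (fun y => P (b - a) * dist (U y) (U x)) (nhds x)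
          (nhds (P (b - a) * dist (U x) (U x))) :=
        (by fun_prop : Continuous fun y => P (b - a) * dist (U y) (U x)).tendsto x
      rw [dist_self, mul_zero] at this
      exact this.mono_left nhdsWithin_le_nhds
  set K : ℝ := 1 / (Real.Gamma α * Real.Gamma (1 - α)) with hK
  have hder : ∀ x ∈ Ioo 0 a,
      HasDerivWithinAt g (K * (x ^ (α - 1) * (b - x) ^ (-α))) (Ioi x) x := by
    intro x hx
    rw [hasDerivWithinAt_iff_tendsto_slope' (by simp)]
    have hUd : HasDerivAt U (x ^ (α - 1) / (c * Real.Gamma α)) x := by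
      refine ((Real.hasDerivAt_rpow_const (p := α) (Or.inl hx.1.ne')).div_const
        (α * c * Real.Gamma α)).congr_deriv ?_
      field_simp
    have hUs : Tendsto (slope U x) (nhdsWithin x (Ioi x)) (nhds (x ^ (α - 1) / (c * Real.Gamma α))) :=
      (hasDerivWithinAt_iff_tendsto_slope' (by simp)).1 hUd.hasDerivWithinAt
    have e : K * (x ^ (α - 1) * (b - x) ^ (-α)) =
        x ^ (α - 1) / (c * Real.Gamma α) * P (b - x) := by
      simp only [hK, hP]; field_simp
    rw [e]
    have hbx : 0 < b - x := by linarith [hx.2]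
    have hPt : Tendsto (fun y => P (b - y)) (nhdsWithin x (Ioi x)) (nhds (P (b - x))) := by
      have h1 : ContinuousAt (fun y => b - y) x := by fun_prop
      exact (ContinuousAt.comp' (f := fun y => b - y) (g := P) (hPc _ hbx) h1).tendsto.mono_left
        nhdsWithin_le_nhds
    have hev : ∀ᶠ y in nhdsWithin x (Ioi x), x < y ∧ y < b :=
      (eventually_mem_nhdsWithin).and
        ((gt_mem_nhds (hx.2.trans hab)).filter_mono nhdsWithin_le_nhds)
    refine tendsto_of_tendsto_of_tendsto_of_le_of_le' (hUs.mul_const (P (b - x))) (hUs.mul hPt) ?_ ?_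
    · filter_upwards [hev] with y hy
      have := (hinc x y hx.1.le hy.1 hy.2).1
      have h2 : 0 < y - x := sub_pos.2 hy.1
      rw [slope_def_field, slope_def_field, div_mul_eq_mul_div]
      gcongr
    · filter_upwards [hev] with y hy
      have := (hinc x y hx.1.le hy.1 hy.2).2
      have h2 : 0 < y - x := sub_pos.2 hy.1
      rw [slope_def_field, slope_def_field, div_mul_eq_mul_div]
      gcongr
  have hIntg : IntervalIntegrable (fun x => K * (x ^ (α - 1) * (b - x) ^ (-α))) volume 0 a := by
    refine IntervalIntegrable.const_mul ?_ K
    refine (intervalIntegral.intervalIntegrable_rpow' (by linarith)).mul_continuousOn ?_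
    intro x hx
    rw [uIcc_of_le ha.le] at hx
    have hbx : 0 < b - x := by linarith [hx.2]
    exact (ContinuousAt.rpow_const (by fun_prop) (Or.inl hbx.ne')).continuousWithinAt
  have hfin := intervalIntegral.integral_eq_sub_of_hasDeriv_right_of_le ha.le hgc hder hIntg
  rw [hg0, sub_zero] at hfin
  change g a = _
  rw [← hfin, Asl, intervalIntegral.integral_const_mul]
  have hsub := intervalIntegral.integral_comp_mul_left (a := 0) (b := a / b)
    (fun x => x ^ (α - 1) * (b - x) ^ (-α)) hb.ne'
  rw [mul_zero, mul_div_cancel₀ _ hb.ne', smul_eq_mul] at hsub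
  have hsub2 : ∫ x in (0:ℝ)..(a/b), (b * x) ^ (α - 1) * (b - b * x) ^ (-α) =
      b⁻¹ * ∫ x in (0:ℝ)..(a/b), x ^ (α - 1) * (1 - x) ^ (-α) := by
    rw [← intervalIntegral.integral_const_mul]
    refine intervalIntegral.integral_congr fun x hx => ?_
    rw [uIcc_of_le (by positivity)] at hx
    have hx1 : x < 1 := hx.2.trans_lt ((div_lt_one hb).2 hab)
    change (b * x) ^ (α - 1) * (b - b * x) ^ (-α) = b⁻¹ * (x ^ (α - 1) * (1 - x) ^ (-α))
    rw [show b - b * x = b * (1 - x) by ring, Real.mul_rpow hb.le hx.1,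
      Real.mul_rpow hb.le (by linarith), Real.rpow_sub hb, Real.rpow_neg hb.le, Real.rpow_one]
    field_simp
  rw [hsub2] at hsub
  have hK2 : K = Real.sin (α * Real.pi) / Real.pi := by
    rw [hK, Real.Gamma_mul_Gamma_one_sub, one_div_div, mul_comm]
  rw [← hK2]
  congr 1
  have := mul_left_cancel₀ (inv_ne_zero hb.ne') hsub
  exact this.symm

end
lemma Asl_cont (α u : ℝ) (hα : α ∈ Set.Ioo (0:ℝ) 1) (hu : u ∈ Ioo (0:ℝ) 1) :
    ContinuousAt (Asl α) u := by
  have hc : ∀ x, x < 1 → ContinuousAt (fun v : ℝ => (1 - v) ^ (-α)) x := fun x hx =>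
    ContinuousAt.rpow_const (by fun_prop) (Or.inl (by linarith))
  have hIntg : IntervalIntegrable (fun v : ℝ => v ^ (α - 1) * (1 - v) ^ (-α)) volume 0 u := by
    refine (intervalIntegral.intervalIntegrable_rpow' (by linarith [hα.1])).mul_continuousOn ?_
    intro x hx
    rw [uIcc_of_le hu.1.le] at hx
    exact (hc x (hx.2.trans_lt hu.2)).continuousWithinAt
  have hm : Measurable (fun v : ℝ => v ^ (α - 1) * (1 - v) ^ (-α)) := by fun_prop
  have := intervalIntegral.integral_hasDerivAt_right hIntg
    hm.stronglyMeasurable.stronglyMeasurableAtFilter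
    ((Real.continuousAt_rpow_const u (α - 1) (Or.inl hu.1.ne')).mul (hc u hu.2))
  exact this.continuousAt.const_mul _

section
variable {Ω : Type*}

lemma pass_ge (V : ℝ → Ω → ℝ) (ω : Ω)
    (hVmono : MonotoneOn (fun t => V t ω) (Set.Ici 0))
    (hVrc : ∀ t : ℝ, 0 ≤ t →
      Tendsto (fun s => V s ω) (nhdsWithin t (Set.Ioi t)) (nhds (V t ω)))
    (b : ℝ) (hne : ∃ t : ℝ, 0 ≤ t ∧ b < V t ω) :
    0 ≤ sInf {t : ℝ | 0 ≤ t ∧ b < V t ω} ∧ b ≤ V (sInf {t : ℝ | 0 ≤ t ∧ b < V t ω}) ω := by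
  set S := {t : ℝ | 0 ≤ t ∧ b < V t ω} with hS
  have hT : 0 ≤ sInf S := Real.sInf_nonneg fun t ht => ht.1
  refine ⟨hT, ?_⟩
  refine ge_of_tendsto (hVrc _ hT) ?_
  filter_upwards [self_mem_nhdsWithin] with s hs
  obtain ⟨t, ht, hts⟩ := exists_lt_of_csInf_lt (s := S) hne hs
  exact (ht.2.trans_le (hVmono ht.1 (mem_Ici.2 (hT.trans (le_of_lt hs))) hts.le)).le

lemma ev1 (V : ℝ → Ω → ℝ) (ω : Ω) (hV0 : V 0 ω = 0)
    (a b : ℝ) (ha : 0 < a) (hab : a < b) (hne : ∃ n : ℕ, b < V n ω)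
    (h : ∀ t : ℝ, 0 ≤ t → V t ω ∉ Set.Icc a b) (k : ℕ) : ω ∈ jumpEv V b k a := by
  have hex : ∃ m : ℕ, b < V (m * (1/2:ℝ)^k) ω := by
    obtain ⟨n, hn⟩ := hne
    refine ⟨n * 2 ^ k, ?_⟩
    have : ((n * 2 ^ k : ℕ) : ℝ) * (1/2:ℝ)^k = n := by
      push_cast
      rw [mul_assoc, ← mul_pow]; norm_num
    rwa [this]
  have hf := Nat.find_spec hex
  obtain ⟨j, hj⟩ : ∃ j, Nat.find hex = j + 1 := by
    refine Nat.exists_eq_succ_of_ne_zero fun h0 => ?_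
    rw [h0] at hf
    simp [hV0] at hf
    linarith
  have hmin := Nat.find_min hex (m := j) (by omega)
  rw [hj] at hf
  refine mem_iUnion.2 ⟨j, ?_, ?_⟩
  · by_contra hcon
    exact h _ (by positivity) ⟨not_lt.1 hcon, not_lt.1 hmin⟩
  · push_cast at hf
    rwa [add_mul, one_mul] at hf

lemma ev2 (V : ℝ → Ω → ℝ) (ω : Ω) (hV0 : V 0 ω = 0)
    (hVmono : MonotoneOn (fun t => V t ω) (Set.Ici 0))
    (hVrc : ∀ t : ℝ, 0 ≤ t →
      Tendsto (fun s => V s ω) (nhdsWithin t (Set.Ioi t)) (nhds (V t ω)))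
    (a b b' : ℝ) (hb : 0 < b) (hb' : b' < b) (hne : ∃ n : ℕ, b < V n ω)
    (h : sSup ((fun s => V s ω) '' Set.Ico 0 (sInf {t : ℝ | 0 ≤ t ∧ b < V t ω})) < a) (k : ℕ) :
    ω ∈ jumpEv V b' k a := by
  obtain ⟨n, hn⟩ := hne
  obtain ⟨hT0, hTb⟩ := pass_ge V ω hVmono hVrc b ⟨n, by positivity, hn⟩
  set T := sInf {t : ℝ | 0 ≤ t ∧ b < V t ω} with hT
  have hTpos : 0 < T := by
    rcases hT0.eq_or_lt with h0 | h0
    · rw [← h0, hV0] at hTb; linarith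
    · exact h0
  have hlt : ∀ s, 0 ≤ s → s < T → V s ω < a := by
    intro s hs hsT
    have hmem : V s ω ∈ (fun s => V s ω) '' Set.Ico 0 T := ⟨s, ⟨hs, hsT⟩, rfl⟩
    refine lt_of_le_of_lt (le_csSup ⟨V T ω, ?_⟩ hmem) h
    rintro _ ⟨r, hr, rfl⟩
    exact hVmono hr.1 hT0 hr.2.le
  have hh : 0 < (1/2:ℝ)^k := by positivity
  obtain ⟨j, hj⟩ : ∃ j, ⌈T / (1/2:ℝ)^k⌉₊ = j + 1 :=
    Nat.exists_eq_succ_of_ne_zero (Nat.ceil_pos.2 (by positivity)).ne'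
  have h1 : T / (1/2:ℝ)^k ≤ j + 1 := by
    have := Nat.le_ceil (T / (1/2:ℝ)^k)
    rw [hj] at this; exact_mod_cast this
  have h2 : (j : ℝ) < T / (1/2:ℝ)^k := Nat.lt_ceil.1 (by omega)
  rw [div_le_iff₀ hh] at h1
  rw [lt_div_iff₀ hh] at h2
  refine mem_iUnion.2 ⟨j, hlt _ (by positivity) h2, ?_⟩
  exact (hb'.trans_le hTb).trans_le
    (hVmono hT0 (mem_Ici.2 (by positivity)) (by linarith))

lemma ev3 (V : ℝ → Ω → ℝ) (ω : Ω)
    (hVmono : MonotoneOn (fun t => V t ω) (Set.Ici 0))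
    (hVrc : ∀ t : ℝ, 0 ≤ t →
      Tendsto (fun s => V s ω) (nhdsWithin t (Set.Ioi t)) (nhds (V t ω)))
    (a b a' b' : ℝ) (ha' : 0 < a') (haa : a' < a) (hab : a < b) (hbb : b < b')
    (h : ∀ k, ω ∈ jumpEv V b' k a') :
    (∀ t : ℝ, 0 ≤ t → V t ω ∉ Set.Icc a b) ∧
    sSup ((fun s => V s ω) '' Set.Ico 0 (sInf {t : ℝ | 0 ≤ t ∧ b < V t ω})) < a := by
  have hne : ∃ t : ℝ, 0 ≤ t ∧ b' < V t ω := by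
    obtain ⟨n, _, h2⟩ := mem_iUnion.1 (h 0)
    exact ⟨_, by positivity, h2⟩
  obtain ⟨hT0, hTb⟩ := pass_ge V ω hVmono hVrc b' hne
  set T := sInf {t : ℝ | 0 ≤ t ∧ b' < V t ω} with hT
  have hlt : ∀ s, 0 ≤ s → s < T → V s ω < a' := by
    intro s hs hsT
    obtain ⟨k, hk⟩ := exists_pow_lt_of_lt_one (sub_pos.2 hsT) (by norm_num : (1/2:ℝ) < 1)
    obtain ⟨n, h1, h2⟩ := mem_iUnion.1 (h k)
    have h3 : T ≤ n * (1/2:ℝ)^k + (1/2:ℝ)^k :=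
      csInf_le ⟨0, fun t ht => ht.1⟩ ⟨by positivity, h2⟩
    exact lt_of_le_of_lt (hVmono hs (mem_Ici.2 (by positivity)) (by linarith)) h1
  have hge : ∀ s, T ≤ s → b < V s ω := fun s hs =>
    (hbb.trans_le hTb).trans_le (hVmono hT0 (mem_Ici.2 (hT0.trans hs)) hs)
  constructor
  · intro t ht hmem
    rcases lt_or_ge t T with h1 | h1
    · linarith [hlt t ht h1, hmem.1]
    · linarith [hge t h1, hmem.2]
  · have hS : {t : ℝ | 0 ≤ t ∧ b < V t ω} = Ici T := by
      ext t
      constructor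
      · rintro ⟨h1, h2⟩
        by_contra hcon
        linarith [hlt t h1 (not_le.1 hcon)]
      · intro h1
        exact ⟨hT0.trans h1, hge t h1⟩
    rw [hS, csInf_Ici]
    refine lt_of_le_of_lt (Real.sSup_le ?_ ha'.le) haa
    rintro _ ⟨s, hs, rfl⟩
    exact (hlt s hs.1 hs.2).le

end

theorem stable_subordinator_jump_over_interval
    {Ω : Type*} [MeasurableSpace Ω] {μ : Measure Ω} [IsProbabilityMeasure μ]
    (α c : ℝ) (hα : α ∈ Set.Ioo (0:ℝ) 1) (hc : 0 < c)
    (a b : ℝ) (ha : 0 < a) (hab : a < b)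
    (V : ℝ → Ω → ℝ)
    (hVmeas : ∀ t, Measurable (V t))
    (hV0 : ∀ ω, V 0 ω = 0)
    (hVmono : ∀ ω, MonotoneOn (fun t => V t ω) (Set.Ici 0))
    (hVrc : ∀ ω, ∀ t : ℝ, 0 ≤ t →
      Tendsto (fun s => V s ω) (nhdsWithin t (Set.Ioi t)) (nhds (V t ω)))
    (hVindep : ∀ s t : ℝ, 0 ≤ s → 0 ≤ t →
      Indep (⨆ u ∈ Set.Icc (0:ℝ) t, MeasurableSpace.comap (V u) inferInstance)
        (MeasurableSpace.comap (fun ω => V (t + s) ω - V t ω) inferInstance) μ)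
    (hVstat : ∀ s t : ℝ, 0 ≤ s → 0 ≤ t →
      Measure.map (fun ω => V (t + s) ω - V t ω) μ = Measure.map (V s) μ)
    (hVlaplace : ∀ t : ℝ, 0 ≤ t → ∀ lam : ℝ, 0 ≤ lam →
      (∫ ω, Real.exp (-(lam * V t ω)) ∂μ) = Real.exp (-(t * c * lam ^ α))) :
    μ {ω | ∀ t : ℝ, 0 ≤ t → V t ω ∉ Set.Icc a b} = ENNReal.ofReal (Asl α (a / b)) ∧
    μ {ω | sSup ((fun s => V s ω) ''
        Set.Ico 0 (sInf {t : ℝ | 0 ≤ t ∧ b < V t ω})) < a}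
      = ENNReal.ofReal (Asl α (a / b)) := by
  have hb : 0 < b := ha.trans hab
  have hpos : ∀ t, 0 ≤ t → ∀ ω, 0 ≤ V t ω := by
    intro t ht ω
    have := hVmono ω (mem_Ici.2 le_rfl) (mem_Ici.2 ht) ht
    simpa only [hV0] using this
  have hval : ∀ a b : ℝ, 0 < a → a < b →
      μ (⋂ k, jumpEv V b k a) = ENNReal.ofReal (Asl α (a / b)) := by
    intro a b ha hab
    rw [← jump_value α c hα hc a b ha hab V hVmeas hpos hVmono hVindep hVstat hVlaplace,
      ENNReal.ofReal_toReal (measure_ne_top _ _)]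
  have hunb : ∀ᵐ ω ∂μ, ∃ n : ℕ, b < V n ω := by
    have h1 := (renewal_lim α c hα hc V hVmeas hpos hVlaplace (b + 1) (by linarith)).1 0
    have h2 := ENNReal.tendsto_atTop_zero_of_tsum_ne_top h1
    rw [ae_iff]
    refine le_antisymm (ge_of_tendsto h2 (Eventually.of_forall fun n => measure_mono ?_)) zero_le
    intro ω hω
    simp only [mem_ofPred_eq, not_exists, not_lt] at hω
    have := hω n
    simp only [mem_ofPred_eq, pow_zero, mul_one]
    linarith
  have hcont : ContinuousAt (fun u => ENNReal.ofReal (Asl α u)) (a / b) :=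
    ENNReal.continuous_ofReal.continuousAt.comp
      (Asl_cont α (a / b) hα ⟨by positivity, (div_lt_one hb).2 hab⟩)
  -- lower bound
  have hlow : ENNReal.ofReal (Asl α (a / b)) ≤
      μ ({ω | ∀ t : ℝ, 0 ≤ t → V t ω ∉ Set.Icc a b} ∩
        {ω | sSup ((fun s => V s ω) ''
          Set.Ico 0 (sInf {t : ℝ | 0 ≤ t ∧ b < V t ω})) < a}) := by
    have ht : Tendsto (fun ε : ℝ => ENNReal.ofReal (Asl α ((a - ε) / (b + ε))))
        (nhdsWithin 0 (Ioi 0)) (nhds (ENNReal.ofReal (Asl α (a / b)))) := by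
      refine hcont.tendsto.comp ?_
      have : ContinuousAt (fun ε : ℝ => (a - ε) / (b + ε)) 0 :=
        ContinuousAt.div (by fun_prop) (by fun_prop) (by simpa using hb.ne')
      have h2 := this.tendsto
      simp only [sub_zero, add_zero] at h2
      exact h2.mono_left nhdsWithin_le_nhds
    refine le_of_tendsto ht ?_
    have hea : ∀ᶠ ε in nhdsWithin (0:ℝ) (Ioi 0), ε < a :=
      (gt_mem_nhds ha).filter_mono nhdsWithin_le_nhds
    filter_upwards [self_mem_nhdsWithin, hea] with ε hε hεa
    have hε' : 0 < ε := hε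
    rw [← hval (a - ε) (b + ε) (by linarith) (by linarith)]
    refine measure_mono fun ω hω => ?_
    exact ev3 V ω (hVmono ω) (hVrc ω) a b (a - ε) (b + ε) (by linarith) (by linarith) hab
      (by linarith) (mem_iInter.1 hω)
  constructor
  · refine le_antisymm ?_ (hlow.trans (measure_mono inter_subset_left))
    rw [← hval a b ha hab]
    refine measure_mono_ae ?_
    filter_upwards [hunb] with ω hω h
    exact mem_iInter.2 (ev1 V ω (hV0 ω) a b ha hab hω h)
  · refine le_antisymm ?_ (hlow.trans (measure_mono inter_subset_right))
    have ht : Tendsto (fun b' : ℝ => ENNReal.ofReal (Asl α (a / b')))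
        (nhdsWithin b (Iio b)) (nhds (ENNReal.ofReal (Asl α (a / b)))) := by
      refine hcont.tendsto.comp ?_
      have : ContinuousAt (fun b' : ℝ => a / b') b :=
        ContinuousAt.div (by fun_prop) (by fun_prop) hb.ne'
      exact this.tendsto.mono_left nhdsWithin_le_nhds
    refine ge_of_tendsto ht ?_
    have hea : ∀ᶠ b' in nhdsWithin b (Iio b), a < b' :=
      (lt_mem_nhds hab).filter_mono nhdsWithin_le_nhds
    filter_upwards [self_mem_nhdsWithin, hea] with b' hb' hab'
    rw [← hval a b' ha hab']
    refine measure_mono_ae ?_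
    filter_upwards [hunb] with ω hω h
    exact mem_iInter.2 (ev2 V ω (hV0 ω) (hVmono ω) (hVrc ω) a b b' hb hb' hω h)
end
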